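/- Let G be a graph on vertex set {1,…,n} and suppose that c_λ ≠ 0 for some partition λ with exactly j parts (λ'_1 = j). Then the sum a_j = Σ_{λ: λ'_1 = j} c_λ is not 0. Moreover, if G is a natural unit interval graph and c_λ(q) ≠ 0 for some partition λ with λ'_1 = j, then the sum a_j(q) = Σ_{λ: λ'_1 = j} c_λ(q) is not the zero polynomial. -/

import Mathlib

open Finset MvPolynomial
open scoped Classical

noncomputable section

/-- `κ` is a proper colouring of `G`. -/
def IsProper {n N : ℕ} (G : SimpleGraph (Fin n)) (κ : Fin n → Fin N) : Prop :=
  ∀ i j, G.Adj i j → κ i ≠ κ j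

/-- The chromatic symmetric function of `G`, truncated to `N` variables. -/
def chromSym (n N : ℕ) (G : SimpleGraph (Fin n)) : MvPolynomial (Fin N) ℤ :=
  ∑ κ : Fin n → Fin N, if IsProper G κ then ∏ i, X (κ i) else 0

/-- The number of ascents of a colouring. -/
def ascNum {n N : ℕ} (G : SimpleGraph (Fin n)) (κ : Fin n → Fin N) : ℕ :=
  ((Finset.univ : Finset (Fin n × Fin n)).filter fun p =>
    G.Adj p.1 p.2 ∧ p.1 < p.2 ∧ κ p.1 < κ p.2).card

/-- The chromatic quasisymmetric function of `G`, with coefficients in `ℤ[q]`,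
truncated to `N` variables. -/
def chromQSym (n N : ℕ) (G : SimpleGraph (Fin n)) :
    MvPolynomial (Fin N) (Polynomial ℤ) :=
  ∑ κ : Fin n → Fin N, if IsProper G κ then
    C (Polynomial.X ^ ascNum G κ) * ∏ i, X (κ i) else 0

/-- `e_λ`, the product of elementary symmetric polynomials over the parts of `λ`. -/
def eProd (N : ℕ) (R : Type) [CommSemiring R] {n : ℕ} (p : Nat.Partition n) :
    MvPolynomial (Fin N) R :=
  (p.parts.map fun k => esymm (Fin N) R k).prod

/-- The number of parts of a partition, i.e. `λ'_1`. -/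
def numParts {n : ℕ} (p : Nat.Partition n) : ℕ := Multiset.card p.parts

/-- The largest part `λ_1` of a partition. -/
def maxPart {n : ℕ} (p : Nat.Partition n) : ℕ := p.parts.sup

/-- `λ'_1 + ⋯ + λ'_k`, the number of cells in the first `k` columns of `λ`. -/
def conjSum {n : ℕ} (p : Nat.Partition n) (k : ℕ) : ℕ :=
  (p.parts.map fun a => min a k).sum

/-- `λ_1 + ⋯ + λ_k`, the number of cells in the first `k` rows of `λ`. -/
def partSum {n : ℕ} (p : Nat.Partition n) (k : ℕ) : ℕ :=
  ∑ j ∈ Finset.Icc 1 n, min (Multiset.card (p.parts.filter fun a => j ≤ a)) k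

/-- `s` is an independent set of vertices of `G`. -/
def IsIndepFinset {V : Type} (G : SimpleGraph V) (s : Finset V) : Prop :=
  ∀ i ∈ s, ∀ j ∈ s, ¬ G.Adj i j

/-- `s` is a clique of `G`. -/
def IsCliqueFinset {V : Type} (G : SimpleGraph V) (s : Finset V) : Prop :=
  ∀ i ∈ s, ∀ j ∈ s, i ≠ j → G.Adj i j

/-- The independence number `α(G)`. -/
def indepNum {n : ℕ} (G : SimpleGraph (Fin n)) : ℕ :=
  sSup {k | ∃ s : Finset (Fin n), IsIndepFinset G s ∧ s.card = k}

/-- The clique number `ω(G)`. -/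
def cliqueNum {n : ℕ} (G : SimpleGraph (Fin n)) : ℕ :=
  sSup {k | ∃ s : Finset (Fin n), IsCliqueFinset G s ∧ s.card = k}

/-- `α_k(G)`: the maximum number of vertices in an independent partition
with `k` blocks. -/
def alphaK {n : ℕ} (G : SimpleGraph (Fin n)) (k : ℕ) : ℕ :=
  sSup {m | ∃ B : Fin k → Finset (Fin n),
    (∀ i j, i ≠ j → Disjoint (B i) (B j)) ∧
    (∀ i, IsIndepFinset G (B i)) ∧ m = ∑ i, (B i).card}

/-- `ω_k(G)`: the maximum number of vertices in a clique partition
with `k` blocks. -/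
def omegaK {n : ℕ} (G : SimpleGraph (Fin n)) (k : ℕ) : ℕ :=
  sSup {m | ∃ B : Fin k → Finset (Fin n),
    (∀ i j, i ≠ j → Disjoint (B i) (B j)) ∧
    (∀ i, IsCliqueFinset G (B i)) ∧ m = ∑ i, (B i).card}

/-- `G` is a natural unit interval graph. -/
def IsNUIG {n : ℕ} (G : SimpleGraph (Fin n)) : Prop :=
  ∀ i j k : Fin n, i < j → j < k → G.Adj i k → G.Adj i j ∧ G.Adj j k

/-- The `q`-integer `[k]_q = 1 + q + ⋯ + q^(k-1)` in `ℤ[q]`. -/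
def qInt (k : ℕ) : Polynomial ℤ := ∑ i ∈ Finset.range k, Polynomial.X ^ i

/-- The `q`-factorial `[k]_q!` in `ℤ[q]`. -/
def qFact : ℕ → Polynomial ℤ
  | 0 => 1
  | k + 1 => qInt (k + 1) * qFact k

end



open Finset MvPolynomial
open scoped Classical

noncomputable section

/-- ascents from `S` to `T` -/
def ascST {n : ℕ} (G : SimpleGraph (Fin n)) (S T : Finset (Fin n)) : ℕ :=
  ((S ×ˢ T).filter fun p => G.Adj p.1 p.2 ∧ p.1 < p.2).card

/-- chromatic function of the induced graph on `U`, at the list of values `l`. -/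
def ZZ {n : ℕ} (G : SimpleGraph (Fin n)) {R : Type*} [CommRing R] (q : R) :
    List R → Finset (Fin n) → R
  | [], U => if U = ∅ then 1 else 0
  | x :: l, U => ∑ S ∈ U.powerset, if IsIndepFinset G S then
      q ^ ascST G S (U \ S) * x ^ S.card * ZZ G q l (U \ S) else 0

/-- two-colour term -/
def tterm {n : ℕ} (G : SimpleGraph (Fin n)) {R : Type*} [CommRing R] (q x y : R)
    (W S : Finset (Fin n)) : R :=
  if IsIndepFinset G S ∧ IsIndepFinset G (W \ S) then
    q ^ ascST G S (W \ S) * x ^ S.card * y ^ (W \ S).card else 0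

/-- two-colour polynomial -/
def PP {n : ℕ} (G : SimpleGraph (Fin n)) {R : Type*} [CommRing R] (q x y : R)
    (W : Finset (Fin n)) : R := ∑ S ∈ W.powerset, tterm G q x y W S

variable {n : ℕ} {G : SimpleGraph (Fin n)} {R : Type*} [CommRing R]

theorem ascST_union_left {A B T : Finset (Fin n)} (h : Disjoint A B) :
    ascST G (A ∪ B) T = ascST G A T + ascST G B T := by
  unfold ascST
  rw [union_product, filter_union, card_union_of_disjoint]
  exact disjoint_filter_filter (disjoint_product.2 (Or.inl h))

theorem ascST_union_right {A B T : Finset (Fin n)} (h : Disjoint A B) :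
    ascST G T (A ∪ B) = ascST G T A + ascST G T B := by
  unfold ascST
  rw [product_union, filter_union, card_union_of_disjoint]
  exact disjoint_filter_filter (disjoint_product.2 (Or.inr h))

theorem ascST_eq_zero {A B : Finset (Fin n)} (h : ∀ a ∈ A, ∀ b ∈ B, G.Adj a b → ¬ a < b) :
    ascST G A B = 0 := by
  unfold ascST
  rw [card_eq_zero, filter_eq_empty_iff]
  rintro ⟨a, b⟩ hp ⟨h1, h2⟩
  rw [mem_product] at hp
  exact h a hp.1 b hp.2 h1 h2

theorem ZZ_map {R' : Type*} [CommRing R'] (f : R →+* R') (q : R) (l : List R)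
    (U : Finset (Fin n)) : f (ZZ G q l U) = ZZ G (f q) (l.map f) U := by
  induction l generalizing U with
  | nil => simp only [ZZ, List.map_nil]; split_ifs <;> simp
  | cons x l ih =>
    simp only [ZZ, List.map_cons, map_sum]
    refine sum_congr rfl fun S _ => ?_
    split_ifs <;> simp [ih]

theorem ZZ_two (q x y : R) (l : List R) (U : Finset (Fin n)) :
    ZZ G q (x :: y :: l) U = ∑ W ∈ U.powerset,
      q ^ ascST G W (U \ W) * ZZ G q l (U \ W) * PP G q x y W := by
  simp only [ZZ, PP, mul_sum]
  have h1 : ∀ S ∈ U.powerset, (if IsIndepFinset G S then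
      q ^ ascST G S (U \ S) * x ^ S.card * ∑ T ∈ (U \ S).powerset, (if IsIndepFinset G T then
      q ^ ascST G T ((U \ S) \ T) * y ^ T.card * ZZ G q l ((U \ S) \ T) else 0) else 0)
      = ∑ T ∈ (U \ S).powerset, if IsIndepFinset G S ∧ IsIndepFinset G T then
      q ^ ascST G S (U \ S) * x ^ S.card * (q ^ ascST G T ((U \ S) \ T) * y ^ T.card *
        ZZ G q l ((U \ S) \ T)) else 0 := by
    intro S _
    split_ifs with h
    · rw [mul_sum]
      refine sum_congr rfl fun T _ => ?_
      simp [h]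
    · simp [h]
  simp only [mul_sum] at h1
  rw [sum_congr rfl h1, sum_sigma', sum_sigma']
  refine sum_bij' (fun p _ => ⟨p.1 ∪ p.2, p.1⟩) (fun p _ => ⟨p.2, p.1 \ p.2⟩) ?_ ?_ ?_ ?_ ?_
  · rintro ⟨S, T⟩ h
    simp only [mem_sigma, mem_powerset] at h ⊢
    exact ⟨union_subset h.1 (h.2.trans sdiff_subset), subset_union_left⟩
  · rintro ⟨S, T⟩ h
    simp only [mem_sigma, mem_powerset] at h ⊢
    exact ⟨h.2.trans h.1, sdiff_subset_sdiff h.1 le_rfl⟩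
  · rintro ⟨S, T⟩ h
    simp only [mem_sigma, mem_powerset] at h ⊢
    have : Disjoint S T := (disjoint_sdiff.mono_right h.2)
    simp [union_sdiff_cancel_left this]
  · rintro ⟨S, T⟩ h
    simp only [mem_sigma, mem_powerset] at h ⊢
    simp [union_sdiff_of_subset h.2]
  · rintro ⟨S, T⟩ h
    simp only [mem_sigma, mem_powerset] at h ⊢
    have hd : Disjoint S T := (disjoint_sdiff.mono_right h.2)
    have e1 : (S ∪ T) \ S = T := union_sdiff_cancel_left hd
    have e2 : (U \ S) \ T = U \ (S ∪ T) := by rw [sdiff_sdiff_left]; rfl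
    have e3 : U \ S = T ∪ (U \ (S ∪ T)) := by
      rw [← e2, union_sdiff_of_subset h.2]
    have hd2 : Disjoint T (U \ (S ∪ T)) := disjoint_sdiff.mono_left subset_union_right
    simp only [tterm, e1]
    split_ifs with h'
    · rw [e2, e3, ascST_union_right hd2, ascST_union_left hd]
      ring
    · simp

theorem ZZ_perm {q : R} (hP : ∀ W (x y : R), PP G q x y W = PP G q y x W) {l l' : List R}
    (h : l.Perm l') (U : Finset (Fin n)) : ZZ G q l U = ZZ G q l' U := by
  induction h generalizing U with
  | nil => rfl
  | cons x _ ih =>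
    simp only [ZZ]
    refine sum_congr rfl fun S _ => ?_
    rw [ih]
  | swap x y l =>
    rw [ZZ_two, ZZ_two]
    refine sum_congr rfl fun S _ => ?_
    rw [hP]
  | trans _ _ ih1 ih2 => rw [ih1, ih2]

theorem PP_symm_one (W : Finset (Fin n)) (x y : R) : PP G 1 x y W = PP G 1 y x W := by
  unfold PP
  refine sum_bij' (fun S _ => W \ S) (fun S _ => W \ S) ?_ ?_ ?_ ?_ ?_
  · intro S _; simp
  · intro S _; simp
  · intro S hS; simpa using mem_powerset.1 hS
  · intro S hS; simpa using mem_powerset.1 hS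
  · intro S hS
    have : W \ (W \ S) = S := by simpa using mem_powerset.1 hS
    simp only [tterm, this, one_pow, one_mul, and_comm, mul_comm, mul_one]

theorem indep_insert {u : Fin n} {S : Finset (Fin n)} : IsIndepFinset G (insert u S) ↔
    IsIndepFinset G S ∧ ∀ s ∈ S, ¬ G.Adj u s := by
  unfold IsIndepFinset
  constructor
  · intro h
    exact ⟨fun i hi j hj => h i (mem_insert_of_mem hi) j (mem_insert_of_mem hj),
      fun s hs => h u (mem_insert_self _ _) s (mem_insert_of_mem hs)⟩
  · rintro ⟨h1, h2⟩ i hi j hj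
    rw [mem_insert] at hi hj
    rcases hi with rfl | hi <;> rcases hj with rfl | hj
    · exact G.irrefl
    · exact h2 j hj
    · exact fun h => h2 i hi h.symm
    · exact h1 i hi j hj

theorem tterm_insert_insert (q x y : R) {u : Fin n} {W S : Finset (Fin n)} (hu : ∀ v ∈ W, v < u)
    (hS : S ⊆ W) : tterm G q x y (insert u W) (insert u S) =
      if ∀ s ∈ S, ¬ G.Adj u s then x * tterm G q x y W S else 0 := by
  have huW : u ∉ W := fun h => lt_irrefl _ (hu u h)
  have huS : u ∉ S := fun h => huW (hS h)
  have e : insert u W \ insert u S = W \ S := by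
    ext a; simp only [mem_sdiff, mem_insert]; grind
  have e2 : ascST G (insert u S) (W \ S) = ascST G S (W \ S) := by
    rw [insert_eq, ascST_union_left (by simpa using huS), ascST_eq_zero, zero_add]
    intro a ha b hb _
    rw [mem_singleton] at ha
    subst ha
    exact not_lt.2 (hu b (mem_sdiff.1 hb).1).le
  unfold tterm
  rw [e, e2, indep_insert, card_insert_of_notMem huS]
  split_ifs <;> first | (exfalso; tauto) | ring

theorem tterm_insert (q x y : R) {u : Fin n} {W S : Finset (Fin n)} (hu : ∀ v ∈ W, v < u)
    (hS : S ⊆ W) : tterm G q x y (insert u W) S =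
      if ∀ s ∈ W \ S, ¬ G.Adj u s then q ^ (S.filter fun s => G.Adj u s).card *
        (y * tterm G q x y W S) else 0 := by
  have huW : u ∉ W := fun h => lt_irrefl _ (hu u h)
  have huS : u ∉ S := fun h => huW (hS h)
  have e : insert u W \ S = insert u (W \ S) := insert_sdiff_of_notMem _ huS
  have huS' : u ∉ W \ S := fun h => huW (mem_sdiff.1 h).1
  have e2 : ascST G S (insert u (W \ S)) = (S.filter fun s => G.Adj u s).card
      + ascST G S (W \ S) := by
    rw [insert_eq, ascST_union_right (by simpa using fun h => absurd h huW)]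
    congr 1
    unfold ascST
    refine card_bij' (fun p _ => p.1) (fun s _ => (s, u)) ?_ ?_ ?_ ?_
    · rintro ⟨a, b⟩ h
      simp only [mem_filter, mem_product, mem_singleton] at h ⊢
      obtain ⟨⟨h1, rfl⟩, h2, -⟩ := h
      exact ⟨h1, h2.symm⟩
    · rintro a h
      simp only [mem_filter, mem_product, mem_singleton] at h ⊢
      exact ⟨⟨h.1, trivial⟩, h.2.symm, hu a (hS h.1)⟩
    · rintro ⟨a, b⟩ h
      simp only [mem_filter, mem_product, mem_singleton] at h ⊢
      simp [h.1.2]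
    · intros; rfl
  unfold tterm
  rw [e, e2, indep_insert, card_insert_of_notMem huS']
  split_ifs <;> first | (exfalso; tauto) | ring

theorem PP_insert (q x y : R) {u : Fin n} {W : Finset (Fin n)} (hu : u ∉ W) :
    PP G q x y (insert u W) = ∑ S ∈ W.powerset, tterm G q x y (insert u W) S +
      ∑ S ∈ W.powerset, tterm G q x y (insert u W) (insert u S) := by
  unfold PP
  rw [sum_powerset_insert hu]

end


open Finset MvPolynomial
open scoped Classical

noncomputable section

variable {n : ℕ} {G : SimpleGraph (Fin n)} {R : Type*} [CommRing R]

theorem PP_split (q x y : R) (W : Finset (Fin n)) (w : Fin n) :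
    PP G q x y W = ∑ S ∈ W.powerset, (if w ∈ S then tterm G q x y W S else 0) +
      ∑ S ∈ W.powerset, (if w ∈ S then 0 else tterm G q x y W S) := by
  unfold PP
  rw [← sum_add_distrib]
  refine sum_congr rfl fun S _ => ?_
  split_ifs <;> simp

theorem tterm_zero (q x y : R) {W S : Finset (Fin n)} {a b c : Fin n} (ha : a ∈ W) (hb : b ∈ W)
    (hc : c ∈ W) (hab : G.Adj a b) (hac : G.Adj a c) (hbc : G.Adj b c) :
    tterm G q x y W S = 0 := by
  unfold tterm
  rw [if_neg]
  rintro ⟨h1, h2⟩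
  by_cases a1 : a ∈ S <;> by_cases b1 : b ∈ S <;> by_cases c1 : c ∈ S
  all_goals first
    | exact h1 a a1 b b1 hab
    | exact h1 a a1 c c1 hac
    | exact h1 b b1 c c1 hbc
    | exact h2 a (mem_sdiff.2 ⟨ha, a1⟩) b (mem_sdiff.2 ⟨hb, b1⟩) hab
    | exact h2 a (mem_sdiff.2 ⟨ha, a1⟩) c (mem_sdiff.2 ⟨hc, c1⟩) hac
    | exact h2 b (mem_sdiff.2 ⟨hb, b1⟩) c (mem_sdiff.2 ⟨hc, c1⟩) hbc

theorem PP_key (hG : IsNUIG G) (q : R) (W : Finset (Fin n)) :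
    (∀ x y, PP G q x y W = PP G q y x W) ∧
    ∀ w ∈ W, (∀ v ∈ W, v ≤ w) → ∃ F : R → R → R, (∀ x y, F x y = F y x) ∧
      ((∀ x y, ∑ S ∈ W.powerset, (if w ∈ S then tterm G q x y W S else 0) = x * F x y ∧
        ∑ S ∈ W.powerset, (if w ∈ S then 0 else tterm G q x y W S) = y * F x y) ∨
       (∀ x y, ∑ S ∈ W.powerset, (if w ∈ S then tterm G q x y W S else 0) = F x y ∧
        ∑ S ∈ W.powerset, (if w ∈ S then 0 else tterm G q x y W S) = q * F x y)) := by
  induction W using Finset.induction_on_max with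
  | empty =>
    refine ⟨fun x y => ?_, by simp⟩
    simp [PP, tterm, IsIndepFinset]
  | insert u W hu ih =>
    have huW : u ∉ W := fun h => lt_irrefl _ (hu u h)
    have key : ∃ F : R → R → R, (∀ x y, F x y = F y x) ∧
      ((∀ x y, ∑ S ∈ (insert u W).powerset, (if u ∈ S then tterm G q x y (insert u W) S else 0)
          = x * F x y ∧
        ∑ S ∈ (insert u W).powerset, (if u ∈ S then 0 else tterm G q x y (insert u W) S)
          = y * F x y) ∨
       (∀ x y, ∑ S ∈ (insert u W).powerset, (if u ∈ S then tterm G q x y (insert u W) S else 0)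
          = F x y ∧
        ∑ S ∈ (insert u W).powerset, (if u ∈ S then 0 else tterm G q x y (insert u W) S)
          = q * F x y)) := by
      have hA : ∀ x y, ∑ S ∈ (insert u W).powerset,
          (if u ∈ S then tterm G q x y (insert u W) S else 0) =
          ∑ S ∈ W.powerset, if ∀ s ∈ S, ¬ G.Adj u s then x * tterm G q x y W S else 0 := by
        intro x y
        rw [sum_powerset_insert huW, sum_eq_zero, zero_add]
        · refine sum_congr rfl fun S hS => ?_
          rw [if_pos (mem_insert_self _ _), tterm_insert_insert _ _ _ hu (mem_powerset.1 hS)]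
        · intro S hS
          rw [if_neg (fun h => huW (mem_powerset.1 hS h))]
      have hB : ∀ x y, ∑ S ∈ (insert u W).powerset,
          (if u ∈ S then 0 else tterm G q x y (insert u W) S) =
          ∑ S ∈ W.powerset, if ∀ s ∈ W \ S, ¬ G.Adj u s then
            q ^ (S.filter fun s => G.Adj u s).card * (y * tterm G q x y W S) else 0 := by
        intro x y
        rw [sum_powerset_insert huW, add_comm, sum_eq_zero, zero_add]
        · refine sum_congr rfl fun S hS => ?_
          rw [if_neg (fun h => huW (mem_powerset.1 hS h)), 
            tterm_insert _ _ _ hu (mem_powerset.1 hS)]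
        · intro S hS
          rw [if_pos (mem_insert_self _ _)]
      by_cases hnb : ∀ w ∈ W, ¬ G.Adj u w
      · -- no neighbours
        refine ⟨fun x y => PP G q x y W, ih.1, Or.inl fun x y => ⟨?_, ?_⟩⟩
        · rw [hA]; simp only [PP]; rw [mul_sum]
          refine sum_congr rfl fun S hS => ?_
          rw [if_pos fun s hs => hnb s (mem_powerset.1 hS hs)]
        · rw [hB]; simp only [PP]; rw [mul_sum]
          refine sum_congr rfl fun S hS => ?_
          rw [if_pos fun s hs => hnb s (mem_sdiff.1 hs).1, filter_eq_empty_iff.2, card_empty,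
            pow_zero, one_mul]
          exact fun s hs => hnb s (mem_powerset.1 hS hs)
      · push Not at hnb
        obtain ⟨w1, hw1, hadj1⟩ := hnb
        obtain ⟨w, hw, hmax⟩ := W.exists_max_image id ⟨w1, hw1⟩
        simp only [id] at hmax
        have hadj : G.Adj u w := by
          rcases eq_or_lt_of_le (hmax w1 hw1) with rfl | hlt
          · exact hadj1
          · exact (hG w1 w u hlt (hu w hw) hadj1.symm).2.symm
        by_cases h2 : ∃ v ∈ W, v ≠ w ∧ G.Adj u v
        · obtain ⟨v, hv, hvw, hav⟩ := h2
          have hvw' : G.Adj v w := 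
            (hG v w u (lt_of_le_of_ne (hmax v hv) hvw) (hu w hw) hav.symm).1
          have hz : ∀ x y S, tterm G q x y (insert u W) S = 0 := fun x y S =>
            tterm_zero q x y (mem_insert_self u W) (mem_insert_of_mem hv) (mem_insert_of_mem hw)
              hav hadj hvw'
          refine ⟨fun _ _ => 0, fun _ _ => rfl, Or.inl fun x y => ?_⟩
          simp [hz]
        · push Not at h2
          have hiff : ∀ S ⊆ W, (∀ s ∈ S, ¬ G.Adj u s) ↔ w ∉ S := by
            intro S hS
            constructor
            · exact fun h hw' => h w hw' hadj
            · intro h s hs hadj'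
              refine h2 s (hS hs) ?_ hadj'
              rintro rfl; exact h hs
          have hA' : ∀ x y, ∑ S ∈ (insert u W).powerset,
              (if u ∈ S then tterm G q x y (insert u W) S else 0) =
              x * ∑ S ∈ W.powerset, (if w ∈ S then 0 else tterm G q x y W S) := by
            intro x y
            rw [hA, mul_sum]
            refine sum_congr rfl fun S hS => ?_
            simp only [hiff S (mem_powerset.1 hS)]
            split_ifs <;> simp_all
          have hB' : ∀ x y, ∑ S ∈ (insert u W).powerset,
              (if u ∈ S then 0 else tterm G q x y (insert u W) S) =
              q * y * ∑ S ∈ W.powerset, (if w ∈ S then tterm G q x y W S else 0) := by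
            intro x y
            rw [hB, mul_sum]
            refine sum_congr rfl fun S hS => ?_
            have : w ∉ W \ S ↔ w ∈ S := by simp [hw]
            simp only [hiff _ (sdiff_subset (s := W) (t := S)), this]
            split_ifs with hwS
            · have : (S.filter fun s => G.Adj u s) = {w} := by
                ext s
                simp only [mem_filter, mem_singleton]
                constructor
                · rintro ⟨hs, ha⟩
                  by_contra hne
                  exact h2 s (mem_powerset.1 hS hs) hne ha
                · rintro rfl; exact ⟨hwS, hadj⟩
              rw [this, card_singleton]; ring
            · simp
          obtain ⟨F, hF, h | h⟩ := ih.2 w hw hmax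
          · refine ⟨fun x y => x * y * F x y, fun x y => by simp only [hF x y]; ring, Or.inr fun x y => ?_⟩
            rw [hA', hB', (h x y).1, (h x y).2]
            constructor <;> ring
          · refine ⟨fun x y => q * F x y, fun x y => by simp only [hF x y], Or.inl fun x y => ?_⟩
            rw [hA', hB', (h x y).1, (h x y).2]
            constructor <;> ring
    constructor
    · intro x y
      obtain ⟨F, hF, h | h⟩ := key
      · rw [PP_split _ _ _ _ u, PP_split _ _ _ _ u, (h x y).1, (h x y).2, (h y x).1, (h y x).2,
          hF y x]
        ring
      · rw [PP_split _ _ _ _ u, PP_split _ _ _ _ u, (h x y).1, (h x y).2, (h y x).1, (h y x).2,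
          hF y x]
    · intro w hw hmax
      have : w = u := by
        rcases mem_insert.1 hw with h | h
        · exact h
        · exact absurd (hmax u (mem_insert_self _ _)) (not_le.2 (hu w h))
      subst this
      exact key

theorem ZZ_union {q : R} {l : List R} {A B : Finset (Fin n)} (hAB : Disjoint A B)
    (h : ∀ a ∈ A, ∀ b ∈ B, ¬ G.Adj a b) :
    ZZ G q l (A ∪ B) = ZZ G q l A * ZZ G q l B := by
  induction l generalizing A B with
  | nil => 
    simp only [ZZ, union_eq_empty]
    split_ifs <;> simp_all
  | cons x l ih =>
    simp only [ZZ]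
    rw [sum_mul_sum, ← sum_product']
    symm
    refine sum_bij' (fun p _ => p.1 ∪ p.2) (fun S _ => (S ∩ A, S ∩ B)) ?_ ?_ ?_ ?_ ?_
    · rintro ⟨S, T⟩ hp
      simp only [mem_product, mem_powerset] at hp ⊢
      exact union_subset_union hp.1 hp.2
    · intro S hS
      simp
    · rintro ⟨S, T⟩ hp
      simp only [mem_product, mem_powerset, disjoint_left, subset_iff] at hp hAB
      ext a <;> simp only [mem_inter, mem_union] <;> grind
    · intro S hS
      simp only [mem_powerset, subset_iff, mem_union] at hS
      ext a
      simp only [mem_inter, mem_union] 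
      grind
    · rintro ⟨S, T⟩ hp
      simp only [mem_product, mem_powerset] at hp ⊢
      have hd : Disjoint S T := hAB.mono hp.1 hp.2
      have e : (A ∪ B) \ (S ∪ T) = (A \ S) ∪ (B \ T) := by
        have := disjoint_left.1 hAB
        have h1 := hp.1
        have h2 := hp.2
        ext a; simp only [mem_sdiff, mem_union]; grind
      have hd' : Disjoint (A \ S) (B \ T) := hAB.mono sdiff_subset sdiff_subset
      have hi : IsIndepFinset G (S ∪ T) ↔ IsIndepFinset G S ∧ IsIndepFinset G T := by
        unfold IsIndepFinset
        constructor
        · intro H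
          exact ⟨fun i hi j hj => H i (mem_union_left _ hi) j (mem_union_left _ hj),
            fun i hi j hj => H i (mem_union_right _ hi) j (mem_union_right _ hj)⟩
        · rintro ⟨H1, H2⟩ i hi j hj
          rcases mem_union.1 hi with hi | hi <;> rcases mem_union.1 hj with hj | hj
          · exact H1 i hi j hj
          · exact h i (hp.1 hi) j (hp.2 hj)
          · exact fun hh => h j (hp.1 hj) i (hp.2 hi) hh.symm
          · exact H2 i hi j hj
      rw [e, ascST_union_left hd, ascST_union_right hd', ascST_union_right hd',
        ih hd' (fun a ha b hb => h a (sdiff_subset ha) b (sdiff_subset hb)),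
        ascST_eq_zero (A := S) (B := B \ T) 
          (fun a ha b hb hh => absurd hh (h a (hp.1 ha) b (sdiff_subset hb))),
        ascST_eq_zero (A := T) (B := A \ S) 
          (fun a ha b hb hh => absurd hh.symm (h b (sdiff_subset hb) a (hp.2 ha))),
        card_union_of_disjoint hd]
      split_ifs <;> first | (exfalso; tauto) | ring

theorem ZZ_biUnion {ι : Type*} {q : R} {l : List R} (s : Finset ι) (A : ι → Finset (Fin n))
    (hd : ∀ i j, i ≠ j → Disjoint (A i) (A j))
    (h : ∀ i j, i ≠ j → ∀ a ∈ A i, ∀ b ∈ A j, ¬ G.Adj a b) :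
    ZZ G q l (s.biUnion A) = ZZ G q l ∅ * ∏ i ∈ s, ZZ G q l (A i) := by
  induction s using Finset.induction_on with
  | empty => simp
  | insert i s hi ih =>
    rw [biUnion_insert, ZZ_union, ih, prod_insert hi]
    · ring
    · rw [disjoint_biUnion_right]
      exact fun j hj => hd i j (by rintro rfl; exact hi hj)
    · intro a ha b hb
      obtain ⟨j, hj, hb⟩ := mem_biUnion.1 hb
      exact h i j (by rintro rfl; exact hi hj) a ha b hb

end


open Finset MvPolynomial
open scoped Classical

noncomputable section

/-- colourings of `U` by naturals below `N`, zero outside `U`. -/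
def KK {n : ℕ} (N : ℕ) (U : Finset (Fin n)) : Finset (Fin n → ℕ) :=
  Fintype.piFinset fun v => if v ∈ U then range N else {0}

/-- weight of a colouring -/
def WW {n : ℕ} (G : SimpleGraph (Fin n)) {R : Type*} [CommRing R] (q : R) (x : ℕ → R)
    (U : Finset (Fin n)) (κ : Fin n → ℕ) : R :=
  if ∀ i ∈ U, ∀ j ∈ U, G.Adj i j → κ i ≠ κ j then
    q ^ ((U ×ˢ U).filter fun p => G.Adj p.1 p.2 ∧ p.1 < p.2 ∧ κ p.1 < κ p.2).card *
      ∏ v ∈ U, x (κ v) else 0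

variable {n : ℕ} {G : SimpleGraph (Fin n)} {R : Type*} [CommRing R]

theorem mem_KK {N : ℕ} {U : Finset (Fin n)} {κ : Fin n → ℕ} :
    κ ∈ KK N U ↔ ∀ v, (v ∈ U → κ v < N) ∧ (v ∉ U → κ v = 0) := by
  unfold KK
  rw [Fintype.mem_piFinset]
  refine forall_congr' fun v => ?_
  split_ifs with h <;> simp [h]

theorem WW_step (q : R) (x : ℕ → R) {U S : Finset (Fin n)} (hS : S ⊆ U) (κ : Fin n → ℕ)
    (h0 : ∀ v ∈ U, κ v = 0 ↔ v ∈ S) :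
    WW G q x U κ = if IsIndepFinset G S then q ^ ascST G S (U \ S) * x 0 ^ S.card *
      WW G q (fun i => x (i + 1)) (U \ S) (fun v => κ v - 1) else 0 := by
  unfold WW
  have hp : (∀ i ∈ U, ∀ j ∈ U, G.Adj i j → κ i ≠ κ j) ↔ IsIndepFinset G S ∧
      (∀ i ∈ U \ S, ∀ j ∈ U \ S, G.Adj i j → κ i - 1 ≠ κ j - 1) := by
    constructor
    · intro h
      refine ⟨fun i hi j hj hij => h i (hS hi) j (hS hj) hij ?_, fun i hi j hj hij => ?_⟩
      · rw [(h0 i (hS hi)).2 hi, (h0 j (hS hj)).2 hj]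
      · rw [mem_sdiff] at hi hj
        have := h i hi.1 j hj.1 hij
        have := h0 i hi.1
        have := h0 j hj.1
        have : κ i ≠ 0 := by tauto
        have : κ j ≠ 0 := by tauto
        omega
    · rintro ⟨h1, h2⟩ i hi j hj hij heq
      by_cases hiS : i ∈ S
      · have : j ∈ S := by rw [← h0 j hj, ← heq, h0 i hi]; exact hiS
        exact h1 i hiS j this hij
      · have : j ∉ S := by rw [← h0 j hj, ← heq, h0 i hi]; exact hiS
        exact h2 i (mem_sdiff.2 ⟨hi, hiS⟩) j (mem_sdiff.2 ⟨hj, this⟩) hij (by rw [heq])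
  have hc : ((U ×ˢ U).filter fun p => G.Adj p.1 p.2 ∧ p.1 < p.2 ∧ κ p.1 < κ p.2).card =
      ascST G S (U \ S) + (((U \ S) ×ˢ (U \ S)).filter fun p => G.Adj p.1 p.2 ∧ p.1 < p.2 ∧
        κ p.1 - 1 < κ p.2 - 1).card := by
    unfold ascST
    rw [← card_union_of_disjoint]
    · congr 1
      ext ⟨a, b⟩
      simp only [mem_filter, mem_product, mem_union, mem_sdiff]
      have ha := h0 a
      have hb := h0 b
      have hSa := @hS a
      have hSb := @hS b
      constructor
      · rintro ⟨⟨h1, h2⟩, h3, h4, h5⟩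
        have hb' : b ∉ S := by rw [← hb h2]; omega
        by_cases haS : a ∈ S
        · exact Or.inl ⟨⟨haS, h2, hb'⟩, h3, h4⟩
        · have : κ a ≠ 0 := by rw [Ne, ha h1]; exact haS
          exact Or.inr ⟨⟨⟨h1, haS⟩, h2, hb'⟩, h3, h4, by omega⟩
      · rintro (⟨⟨h1, h2, h3⟩, h4, h5⟩ | ⟨⟨⟨h1, h1'⟩, h2, h2'⟩, h3, h4, h5⟩)
        · have e1 := (ha (hSa h1)).2 h1
          have e2 : κ b ≠ 0 := by rw [Ne, hb h2]; exact h3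
          exact ⟨⟨hSa h1, h2⟩, h4, h5, by omega⟩
        · exact ⟨⟨h1, h2⟩, h3, h4, by omega⟩
    · rw [disjoint_left]
      rintro ⟨a, b⟩ h1 h2
      simp only [mem_filter, mem_product, mem_sdiff] at h1 h2
      exact h2.1.1.2 h1.1.1
  have hx : ∏ v ∈ U, x (κ v) = x 0 ^ S.card * ∏ v ∈ U \ S, x (κ v - 1 + 1) := by
    rw [← prod_sdiff hS, mul_comm]
    congr 1
    · rw [← prod_const]
      exact prod_congr rfl fun v hv => by rw [(h0 v (hS hv)).2 hv]
    · refine prod_congr rfl fun v hv => ?_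
      rw [mem_sdiff] at hv
      have : κ v ≠ 0 := by rw [Ne, h0 v hv.1]; exact hv.2
      rw [Nat.sub_add_cancel (by omega)]
  rw [hc, hx]
  simp only [hp]
  split_ifs <;> first | (exfalso; tauto) | ring

theorem ZZ_eq_sum (q : R) (N : ℕ) (x : ℕ → R) (U : Finset (Fin n)) :
    ZZ G q ((List.range N).map x) U = ∑ κ ∈ KK N U, WW G q x U κ := by
  induction N generalizing x U with
  | zero =>
    simp only [List.range_zero, List.map_nil, ZZ]
    split_ifs with h
    · subst h
      have : KK 0 (∅ : Finset (Fin n)) = {fun _ => 0} := by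
        ext κ; rw [mem_KK, mem_singleton]; simp [funext_iff]
      rw [this, sum_singleton]
      simp [WW]
    · symm
      apply sum_eq_zero
      intro κ hκ
      obtain ⟨v, hv⟩ := nonempty_iff_ne_empty.2 h
      exact absurd ((mem_KK.1 hκ v).1 hv) (by simp)
  | succ N ih =>
    rw [List.range_succ_eq_map, List.map_cons, List.map_map]
    simp only [ZZ]
    have hmaps : ∀ κ ∈ KK (N + 1) U, (U.filter fun v => κ v = 0) ∈ U.powerset := by
      intro κ _
      rw [mem_powerset]
      exact filter_subset _ _
    rw [← sum_fiberwise_of_maps_to hmaps]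
    refine sum_congr rfl fun S hS => ?_
    rw [mem_powerset] at hS
    have h1 : ∀ κ ∈ (KK (N + 1) U).filter (fun κ => (U.filter fun v => κ v = 0) = S),
        WW G q x U κ = if IsIndepFinset G S then q ^ ascST G S (U \ S) * x 0 ^ S.card *
      WW G q (fun i => x (i + 1)) (U \ S) (fun v => κ v - 1) else 0 := by
      intro κ hκ
      apply WW_step q x hS
      intro v hv
      rw [← (mem_filter.1 hκ).2]
      simp [hv]
    rw [sum_congr rfl h1]
    split_ifs with hi
    · have := ih (x ∘ Nat.succ) (U \ S)
      rw [this, ← mul_sum]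
      congr 1
      symm
      refine sum_bij' (fun κ _ => fun v => κ v - 1) (fun κ _ => fun v => if v ∈ U \ S then κ v + 1 
        else 0) ?_ ?_ ?_ ?_ ?_
      · intro κ hκ
        rw [mem_filter, mem_KK] at hκ
        rw [mem_KK]
        obtain ⟨h, rfl⟩ := hκ
        intro v
        have := h v
        simp only [mem_sdiff, mem_filter, not_and]
        constructor
        · rintro ⟨h1, h2⟩
          have := h2 h1
          have := (h v).1 h1
          omega
        · intro h1
          by_cases hv : v ∈ U
          · have h3 : κ v = 0 := by
              by_contra h2
              exact h1 hv (fun _ => h2)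
            rw [h3]
          · rw [(h v).2 hv]
      · intro κ hκ
        rw [mem_KK] at hκ
        rw [mem_filter, mem_KK]
        refine ⟨fun v => ?_, ?_⟩
        · have h1 := hκ v
          constructor
          · intro hv
            split_ifs with h2
            · have := h1.1 h2; omega
            · omega
          · intro hv
            rw [if_neg]
            exact fun h => hv (sdiff_subset h)
        · ext v
          simp only [mem_filter, mem_sdiff]
          constructor
          · rintro ⟨h1, h2⟩
            by_contra h3
            rw [if_pos ⟨h1, h3⟩] at h2
            omega
          · intro h
            refine ⟨hS h, ?_⟩
            rw [if_neg]
            tauto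
      · intro κ hκ
        rw [mem_filter, mem_KK] at hκ
        obtain ⟨h, rfl⟩ := hκ
        funext v
        simp only [mem_sdiff, mem_filter, not_and]
        by_cases hv : v ∈ U
        · by_cases h0 : κ v = 0
          · simp [h0]
          · rw [if_pos ⟨hv, fun _ => h0⟩]; omega
        · rw [if_neg (fun h => hv h.1), (h v).2 hv]
      · intro κ hκ
        rw [mem_KK] at hκ
        funext v
        show (if v ∈ U \ S then κ v + 1 else 0) - 1 = κ v
        split_ifs with h1
        · simp
        · rw [(hκ v).2 h1]
      · intro κ hκ
        rfl
    · simp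

theorem ZZ_eq_fin (q : R) (N : ℕ) (x : Fin N → R) :
    ZZ G q (List.ofFn x) univ = ∑ κ : Fin n → Fin N,
      if IsProper G κ then q ^ ascNum G κ * ∏ i, x (κ i) else 0 := by
  have : List.ofFn x = (List.range N).map (fun i => if h : i < N then x ⟨i, h⟩ else 0) := by
    apply List.ext_getElem
    · simp
    · intro i h1 h2
      simp at h1
      simp [h1]
  rw [this, ZZ_eq_sum]
  symm
  refine sum_bij (fun κ _ v => (κ v : ℕ)) ?_ ?_ ?_ ?_
  · intro κ _
    rw [mem_KK]
    intro v
    exact ⟨fun _ => (κ v).2, fun h => absurd (mem_univ _) h⟩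
  · intro κ _ κ' _ h
    funext v
    exact Fin.ext (congrFun h v)
  · intro κ hκ
    rw [mem_KK] at hκ
    exact ⟨fun v => ⟨κ v, (hκ v).1 (mem_univ _)⟩, mem_univ _, rfl⟩
  · intro κ _
    have e : IsProper G κ ↔ ∀ i ∈ univ, ∀ j ∈ univ, G.Adj i j → (κ i : ℕ) ≠ κ j := by
      simp [IsProper, Fin.ext_iff]
    unfold WW
    simp only [e]
    congr 1
    simp [ascNum]

theorem chromSym_eq (N : ℕ) : chromSym n N G = ZZ G 1 (List.ofFn X) univ := by
  rw [ZZ_eq_fin]; simp [chromSym]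

theorem chromQSym_eq (N : ℕ) : chromQSym n N G = 
    ZZ G (C Polynomial.X) (List.ofFn X) univ := by
  rw [ZZ_eq_fin]; simp [chromQSym]

end


open Finset MvPolynomial
open scoped Classical

noncomputable section

/-- acyclic orientations of the induced graph on `U`. -/
def AO {n : ℕ} (G : SimpleGraph (Fin n)) (U : Finset (Fin n)) : Finset (Finset (Fin n × Fin n)) :=
  univ.filter fun D => (∀ a b, (a, b) ∈ D → a ∈ U ∧ b ∈ U ∧ G.Adj a b) ∧
    (∀ a ∈ U, ∀ b ∈ U, G.Adj a b → (a, b) ∈ D ∨ (b, a) ∈ D) ∧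
    ∃ h : Fin n → ℕ, ∀ a b, (a, b) ∈ D → h b < h a

/-- sinks -/
def snk {n : ℕ} (U : Finset (Fin n)) (D : Finset (Fin n × Fin n)) : Finset (Fin n) :=
  U.filter fun v => ∀ w, (v, w) ∉ D

variable {n : ℕ} {G : SimpleGraph (Fin n)}

theorem mem_AO {U : Finset (Fin n)} {D : Finset (Fin n × Fin n)} : D ∈ AO G U ↔
    (∀ a b, (a, b) ∈ D → a ∈ U ∧ b ∈ U ∧ G.Adj a b) ∧
    (∀ a ∈ U, ∀ b ∈ U, G.Adj a b → (a, b) ∈ D ∨ (b, a) ∈ D) ∧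
    ∃ h : Fin n → ℕ, ∀ a b, (a, b) ∈ D → h b < h a := by
  simp [AO]

theorem mem_snk {U : Finset (Fin n)} {D : Finset (Fin n × Fin n)} {v : Fin n} : v ∈ snk U D ↔
    v ∈ U ∧ ∀ w, (v, w) ∉ D := by
  simp [snk]

theorem indep_of_snk {U S : Finset (Fin n)} {D : Finset (Fin n × Fin n)} (hD : D ∈ AO G U)
    (hS : S ⊆ snk U D) : IsIndepFinset G S := by
  intro i hi j hj hij
  have h1 := mem_snk.1 (hS hi)
  have h2 := mem_snk.1 (hS hj)
  rcases (mem_AO.1 hD).2.1 i h1.1 j h2.1 hij with h | h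
  · exact h1.2 _ h
  · exact h2.2 _ h

theorem card_AO_sdiff {U S : Finset (Fin n)} (hSU : S ⊆ U) (hS : IsIndepFinset G S) :
    ((AO G U).filter fun D => S ⊆ snk U D).card = (AO G (U \ S)).card := by
  refine card_bij' (fun D _ => D.filter fun p => p.1 ∉ S ∧ p.2 ∉ S)
    (fun D _ => D ∪ (univ.filter fun p : Fin n × Fin n => p.1 ∈ U \ S ∧ p.2 ∈ S ∧ G.Adj p.1 p.2))
    ?_ ?_ ?_ ?_
  · intro D hD
    rw [mem_filter, mem_AO] at hD
    obtain ⟨⟨h1, h2, h, h3⟩, h4⟩ := hD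
    rw [mem_AO]
    refine ⟨?_, ?_, h, ?_⟩
    · intro a b hab
      rw [mem_filter] at hab
      have := h1 a b hab.1
      simp only [mem_sdiff]
      exact ⟨⟨this.1, hab.2.1⟩, ⟨this.2.1, hab.2.2⟩, this.2.2⟩
    · intro a ha b hb hab
      rw [mem_sdiff] at ha hb
      simp only [mem_filter]
      rcases h2 a ha.1 b hb.1 hab with h | h
      · exact Or.inl ⟨h, ha.2, hb.2⟩
      · exact Or.inr ⟨h, hb.2, ha.2⟩
    · intro a b hab
      exact h3 a b (mem_filter.1 hab).1
  · intro D hD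
    rw [mem_AO] at hD
    obtain ⟨h1, h2, h, h3⟩ := hD
    rw [mem_filter, mem_AO]
    refine ⟨⟨?_, ?_, fun v => if v ∈ S then 0 else h v + 1, ?_⟩, ?_⟩
    · intro a b hab
      simp only [mem_union, mem_filter, mem_univ, true_and] at hab
      rcases hab with hab | hab
      · have := h1 a b hab
        exact ⟨sdiff_subset this.1, sdiff_subset this.2.1, this.2.2⟩
      · exact ⟨sdiff_subset hab.1, hSU hab.2.1, hab.2.2⟩
    · intro a ha b hb hab
      simp only [mem_union, mem_filter, mem_univ, true_and, mem_sdiff]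
      by_cases haS : a ∈ S <;> by_cases hbS : b ∈ S
      · exact absurd hab (hS a haS b hbS)
      · exact Or.inr (Or.inr ⟨⟨hb, hbS⟩, haS, hab.symm⟩)
      · exact Or.inl (Or.inr ⟨⟨ha, haS⟩, hbS, hab⟩)
      · rcases h2 a (mem_sdiff.2 ⟨ha, haS⟩) b (mem_sdiff.2 ⟨hb, hbS⟩) hab with h | h
        · exact Or.inl (Or.inl h)
        · exact Or.inr (Or.inl h)
    · intro a b hab
      simp only [mem_union, mem_filter, mem_univ, true_and] at hab
      beta_reduce
      rcases hab with hab | hab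
      · have := h1 a b hab
        rw [mem_sdiff, mem_sdiff] at this
        have h' := h3 a b hab
        rw [if_neg this.1.2, if_neg this.2.1.2]
        omega
      · rw [if_pos hab.2.1, if_neg (mem_sdiff.1 hab.1).2]
        omega
    · intro s hs
      rw [mem_snk]
      refine ⟨hSU hs, fun w hw => ?_⟩
      simp only [mem_union, mem_filter, mem_univ, true_and] at hw
      rcases hw with hw | hw
      · exact (mem_sdiff.1 (h1 s w hw).1).2 hs
      · exact (mem_sdiff.1 hw.1).2 hs
  · intro D hD
    rw [mem_filter, mem_AO] at hD
    obtain ⟨⟨h1, h2, h, h3⟩, h4⟩ := hD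
    ext ⟨a, b⟩
    simp only [mem_union, mem_filter, mem_univ, true_and, mem_sdiff]
    constructor
    · rintro (h | ⟨⟨ha, haS⟩, hb, hab⟩)
      · exact h.1
      · rcases h2 a ha b (hSU hb) hab with h | h
        · exact h
        · exact absurd h ((mem_snk.1 (h4 hb)).2 a)
    · intro hab
      have haS : a ∉ S := fun ha => (mem_snk.1 (h4 ha)).2 b hab
      have := h1 a b hab
      by_cases hb : b ∈ S
      · exact Or.inr ⟨⟨this.1, haS⟩, hb, this.2.2⟩
      · exact Or.inl ⟨hab, haS, hb⟩
  · intro D hD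
    rw [mem_AO] at hD
    obtain ⟨h1, h2, h, h3⟩ := hD
    ext ⟨a, b⟩
    simp only [mem_union, mem_filter, mem_univ, true_and, mem_sdiff]
    constructor
    · rintro ⟨h | h, h'⟩
      · exact h
      · exact absurd h.2.1 h'.2
    · intro hab
      have := h1 a b hab
      rw [mem_sdiff, mem_sdiff] at this
      exact ⟨Or.inl hab, this.1.2, this.2.1.2⟩

theorem sum_AO (t : ℚ) (U : Finset (Fin n)) :
    (∑ S ∈ U.powerset, if IsIndepFinset G S then (t - 1) ^ S.card * ((AO G (U \ S)).card : ℚ)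
      else 0) = ∑ D ∈ AO G U, t ^ (snk U D).card := by
  have h1 : ∀ D ∈ AO G U, t ^ (snk U D).card = ∑ S ∈ U.powerset,
      if S ⊆ snk U D then (t - 1) ^ S.card else 0 := by
    intro D _
    have := Finset.sum_pow_mul_eq_add_pow (t - 1) 1 (snk U D)
    simp only [one_pow, mul_one, sub_add_cancel] at this
    rw [← this, ← sum_filter]
    refine sum_congr ?_ fun _ _ => rfl
    ext S
    simp only [mem_powerset, mem_filter]
    exact ⟨fun h => ⟨h.trans (filter_subset _ _), h⟩, fun h => h.2⟩
  rw [sum_congr rfl h1, sum_comm]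
  refine sum_congr rfl fun S hS => ?_
  rw [mem_powerset] at hS
  rw [← sum_filter, sum_const, nsmul_eq_mul, mul_comm]
  split_ifs with h
  · rw [card_AO_sdiff hS h]
  · have : (AO G U).filter (fun D => S ⊆ snk U D) = ∅ := by
      rw [filter_eq_empty_iff]
      exact fun D hD hS' => h (indep_of_snk hD hS')
    rw [this]; simp

theorem snk_nonempty {U : Finset (Fin n)} (hU : U.Nonempty) {D : Finset (Fin n × Fin n)}
    (hD : D ∈ AO G U) : (snk U D).Nonempty := by
  rw [mem_AO] at hD
  obtain ⟨h1, h2, h, h3⟩ := hD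
  obtain ⟨v, hv, hmin⟩ := exists_min_image U h hU
  refine ⟨v, mem_snk.2 ⟨hv, fun w hw => ?_⟩⟩
  exact absurd (h3 v w hw) (not_lt.2 (hmin w (h1 v w hw).2.1))

theorem sum_AO_zero (U : Finset (Fin n)) :
    (∑ S ∈ U.powerset, if IsIndepFinset G S then (-1) ^ S.card * ((AO G (U \ S)).card : ℚ)
      else 0) = if U = ∅ then 1 else 0 := by
  have := sum_AO (G := G) 0 U
  rw [zero_sub] at this
  rw [this]
  split_ifs with h
  · subst h
    have : AO G ∅ = {∅} := by
      ext D
      rw [mem_AO, mem_singleton]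
      constructor
      · rintro ⟨h1, -⟩
        ext ⟨a, b⟩
        simp only [notMem_empty, iff_false]
        exact fun h => absurd (h1 a b h).1 (by simp)
      · rintro rfl
        simp
    rw [this]
    simp [snk]
  · apply sum_eq_zero
    intro D hD
    have := snk_nonempty (nonempty_iff_ne_empty.2 h) hD
    exact zero_pow (card_pos.2 this).ne'

theorem antidiff (Q : Polynomial ℚ) (c : ℚ) : ∃ P : Polynomial ℚ, P.eval 0 = c ∧
    ∀ x, P.eval (x + 1) = P.eval x + Q.eval x := by
  have h : ∃ P : Polynomial ℚ, ∀ x, P.eval (x + 1) = P.eval x + Q.eval x := by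
    induction Q using Polynomial.induction_on' with
    | add p q hp hq =>
      obtain ⟨P, hP⟩ := hp
      obtain ⟨P', hP'⟩ := hq
      refine ⟨P + P', fun x => ?_⟩
      simp only [Polynomial.eval_add, hP, hP']
      ring
    | monomial m a =>
      refine ⟨Polynomial.C (a / (m + 1)) * Polynomial.bernoulli (m + 1), fun x => ?_⟩
      have := Polynomial.bernoulli_eval_one_add (m + 1) x
      rw [add_comm x 1, Polynomial.eval_mul, this, Polynomial.eval_mul]
      simp only [Polynomial.eval_C, Polynomial.eval_monomial, Nat.add_sub_cancel]
      push_cast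
      have : (m : ℚ) + 1 ≠ 0 := by positivity
      field_simp
  obtain ⟨P, hP⟩ := h
  refine ⟨P + Polynomial.C (c - P.eval 0), by simp, fun x => ?_⟩
  simp only [Polynomial.eval_add, hP, Polynomial.eval_C]
  ring

theorem exists_chi (U : Finset (Fin n)) : ∃ p : Polynomial ℚ,
    (∀ r : ℕ, p.eval (r : ℚ) = ZZ G 1 (List.replicate r (-1)) U) ∧
    p.eval (-1) = (AO G U).card := by
  induction U using Finset.strongInduction with
  | H U ih =>
    have ih' : ∀ S : Finset (Fin n), S ≠ ∅ → S ⊆ U → ∃ p : Polynomial ℚ,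
        (∀ r : ℕ, p.eval (r : ℚ) = ZZ G 1 (List.replicate r (-1)) (U \ S)) ∧
        p.eval (-1) = (AO G (U \ S)).card := by
      intro S h1 h2
      exact ih _ (sdiff_ssubset h2 (nonempty_iff_ne_empty.2 h1))
    choose! p hp hp' using ih'
    obtain ⟨P, hP0, hP⟩ := antidiff (∑ S ∈ U.powerset.erase ∅, if IsIndepFinset G S then
      Polynomial.C ((-1) ^ S.card) * p S else 0) (if U = ∅ then 1 else 0)
    have hempty : IsIndepFinset G (∅ : Finset (Fin n)) := by simp [IsIndepFinset]
    have hmem : ∅ ∈ U.powerset := by simp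
    have hP' : ∀ x, P.eval (x + 1) = P.eval x + ∑ S ∈ U.powerset.erase ∅, 
        if IsIndepFinset G S then (-1) ^ S.card * (p S).eval x else 0 := by
      intro x
      rw [hP, Polynomial.eval_finsetSum]
      congr 1
      refine sum_congr rfl fun S _ => ?_
      split_ifs <;> simp
    refine ⟨P, ?_, ?_⟩
    · intro r
      induction r with
      | zero => simp [hP0, ZZ]
      | succ r ihr =>
        push_cast
        rw [hP', ihr, List.replicate_succ]
        conv_rhs => rw [ZZ]
        rw [← add_sum_erase _ _ hmem, if_pos hempty]
        simp only [one_pow, card_empty, pow_zero, one_mul, sdiff_empty]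
        congr 1
        refine sum_congr rfl fun S hS => ?_
        rw [mem_erase, mem_powerset] at hS
        rw [hp S hS.1 hS.2]
    · have h1 := hP' (-1)
      rw [neg_add_cancel, hP0, ← sum_AO_zero (G := G), ← add_sum_erase _ _ hmem, 
        if_pos hempty] at h1
      simp only [card_empty, pow_zero, one_mul, sdiff_empty] at h1
      have h2 : ∀ S ∈ U.powerset.erase ∅, (if IsIndepFinset G S then (-1) ^ S.card * 
          (p S).eval (-1) else 0) = if IsIndepFinset G S then (-1) ^ S.card * 
            ((AO G (U \ S)).card : ℚ) else 0 := by
        intro S hS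
        rw [mem_erase, mem_powerset] at hS
        rw [hp' S hS.1 hS.2]
      rw [sum_congr rfl h2] at h1
      linarith

theorem mesymm_zero {R : Type*} [CommRing R] (s : Multiset R) : s.esymm 0 = 1 := by
  simp [Multiset.esymm]

theorem mesymm_cons {R : Type*} [CommRing R] (a : R) (s : Multiset R) (k : ℕ) :
    (a ::ₘ s).esymm (k + 1) = s.esymm (k + 1) + a * s.esymm k := by
  simp only [Multiset.esymm, Multiset.powersetCard_cons, Multiset.map_add, Multiset.sum_add,
    Multiset.map_map, Function.comp_def, Multiset.prod_cons, Multiset.sum_map_mul_left]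

theorem exists_bin (k : ℕ) : ∃ p : Polynomial ℚ,
    (∀ r : ℕ, p.eval (r : ℚ) = (Multiset.replicate r (-1 : ℚ)).esymm k) ∧ p.eval (-1) = 1 := by
  induction k with
  | zero => exact ⟨1, by simp [mesymm_zero], by simp⟩
  | succ k ih =>
    obtain ⟨p, hp, hp'⟩ := ih
    obtain ⟨P, hP0, hP⟩ := antidiff (-p) 0
    refine ⟨P, ?_, ?_⟩
    · intro r
      induction r with
      | zero => simp [hP0, Multiset.esymm, Multiset.powersetCard_zero_right]
      | succ r ihr =>
        push_cast
        rw [hP, ihr, Multiset.replicate_succ, mesymm_cons, Polynomial.eval_neg, hp]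
        ring
    · have := hP (-1)
      rw [neg_add_cancel, hP0, Polynomial.eval_neg, hp'] at this
      linarith

end


open Finset MvPolynomial
open scoped Classical

noncomputable section

/-- product of elementary symmetric values of a multiset over the parts of a partition -/
def EP {n : ℕ} {R : Type*} [CommRing R] (s : Multiset R) (p : Nat.Partition n) : R :=
  (p.parts.map fun k => s.esymm k).prod

variable {n : ℕ} {G : SimpleGraph (Fin n)}

theorem map_mesymm {R R' : Type*} [CommRing R] [CommRing R'] (f : R →+* R') (s : Multiset R)
    (k : ℕ) : f (s.esymm k) = (s.map f).esymm k := by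
  simp only [Multiset.esymm, map_multiset_sum, Multiset.map_map, Multiset.powersetCard_map,
    Function.comp_def, map_multiset_prod]

theorem map_EP {R R' : Type*} [CommRing R] [CommRing R'] (f : R →+* R') (s : Multiset R)
    (p : Nat.Partition n) : f (EP s p) = EP (s.map f) p := by
  simp only [EP, map_multiset_prod, Multiset.map_map, Function.comp_def, map_mesymm]

theorem esymm_eq_ofFn (N : ℕ) (R : Type*) [CommRing R] (k : ℕ) : esymm (Fin N) R k =
    Multiset.esymm (↑(List.ofFn (X : Fin N → MvPolynomial (Fin N) R))) k := by
  rw [esymm_eq_multiset_esymm, Fin.univ_val_map]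

theorem eProd_eq (N : ℕ) (R : Type) [CommRing R] (p : Nat.Partition n) : eProd N R p =
    EP (↑(List.ofFn (X : Fin N → MvPolynomial (Fin N) R))) p := by
  simp only [eProd, EP, esymm_eq_ofFn]

theorem esymm_homog (N : ℕ) (R : Type*) [CommRing R] (k : ℕ) :
    (esymm (Fin N) R k).IsHomogeneous k := by
  unfold esymm
  refine IsHomogeneous.sum _ _ _ fun t ht => ?_
  have := IsHomogeneous.prod t (fun i => (X i : MvPolynomial (Fin N) R)) (fun _ => 1)
    (fun i _ => isHomogeneous_X _ _)
  rw [mem_powersetCard] at ht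
  simpa [ht.2] using this

theorem eProd_homog (N : ℕ) (R : Type) [CommRing R] (p : Nat.Partition n) :
    (eProd N R p).IsHomogeneous n := by
  have h : ∀ s : Multiset ℕ, ((s.map fun k => esymm (Fin N) R k).prod).IsHomogeneous s.sum := by
    intro s
    induction s using Multiset.induction with
    | empty => simpa using isHomogeneous_one _ _
    | cons a s ih =>
      rw [Multiset.map_cons, Multiset.prod_cons, Multiset.sum_cons]
      exact (esymm_homog N R a).mul ih
  have := h p.parts
  rwa [p.parts_sum] at this

theorem eProd_symm (N : ℕ) (R : Type) [CommRing R] (p : Nat.Partition n) :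
    (eProd N R p).IsSymmetric := by
  have h : ∀ s : Multiset ℕ, ((s.map fun k => esymm (Fin N) R k).prod).IsSymmetric := by
    intro s
    induction s using Multiset.induction with
    | empty => simp
    | cons a s ih =>
      rw [Multiset.map_cons, Multiset.prod_cons]
      exact (esymm_isSymmetric _ _ a).mul ih
  exact h _

theorem ZZ_symm {N : ℕ} {R : Type*} [CommRing R] {q : R}
    (hP : ∀ W (x y : MvPolynomial (Fin N) R), PP G (C q) x y W = PP G (C q) y x W)
    (U : Finset (Fin n)) : (ZZ G (C q : MvPolynomial (Fin N) R) (List.ofFn X) U).IsSymmetric := by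
  intro e
  have := ZZ_map (G := G) (rename e : MvPolynomial (Fin N) R →ₐ[R] _).toRingHom (C q)
    (List.ofFn X) U
  simp only [AlgHom.toRingHom_eq_coe, RingHom.coe_coe, rename_C, List.map_ofFn] at this
  rw [this]
  refine ZZ_perm hP ?_ U
  refine (List.Perm.of_eq ?_).trans (Equiv.Perm.ofFn_comp_perm e X)
  congr 1
  ext1 i
  simp

theorem ZZ_homog {N : ℕ} {R : Type*} [CommRing R] {q : R} :
    (ZZ G (C q : MvPolynomial (Fin N) R) (List.ofFn X) univ).IsHomogeneous n := by
  rw [ZZ_eq_fin]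
  refine IsHomogeneous.sum _ _ _ fun κ _ => ?_
  split_ifs
  · rw [← C_pow]
    have := IsHomogeneous.prod univ (fun i => (X (κ i) : MvPolynomial (Fin N) R)) (fun _ => 1)
      (fun i _ => isHomogeneous_X _ _)
    simpa using this.C_mul (q ^ ascNum G κ)
  · exact isHomogeneous_zero _ _ _

theorem stab {N : ℕ} {R : Type*} [CommRing R] (f : MvPolynomial (Fin (N + 1)) R)
    (hs : f.IsSymmetric) (hd : f.IsHomogeneous n) (hn : n ≤ N)
    (h0 : Polynomial.coeff (finSuccEquiv R N f) 0 = 0) : f = 0 := by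
  ext m
  rw [coeff_zero]
  by_contra hne
  have hdeg := hd hne
  have : ∃ i, m i = 0 := by
    by_contra! hcon
    have h1 : ∑ i : Fin (N + 1), 1 ≤ ∑ i, m i :=
      sum_le_sum fun i _ => Nat.one_le_iff_ne_zero.2 (hcon i)
    have h2 : ∑ i, m i = n := by
      rw [← hdeg, Finsupp.weight_apply, Finsupp.sum_fintype] <;> simp
    simp at h1
    omega
  obtain ⟨i, hi⟩ := this
  apply hne
  have h1 := coeff_rename_mapDomain (Equiv.swap 0 i) (Equiv.injective _) f m
  rw [hs] at h1
  rw [← h1]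
  set m' := m.mapDomain (Equiv.swap 0 i)
  have h2 : m' 0 = 0 := by
    have := Finsupp.mapDomain_apply (Equiv.injective (Equiv.swap 0 i)) m i
    rwa [Equiv.swap_apply_right, hi] at this
  have h3 := finSuccEquiv_coeff_coeff m'.tail f 0
  rw [h0, coeff_zero, ← h2, Finsupp.cons_tail] at h3
  exact h3.symm

theorem ZZ_zero_cons {R : Type*} [CommRing R] (q : R) (l : List R) (U : Finset (Fin n)) :
    ZZ G q (0 :: l) U = ZZ G q l U := by
  rw [ZZ, sum_eq_single ∅]
  · rw [if_pos (by intro i hi; simp at hi), ascST_eq_zero (by intro i hi; simp at hi)]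
    simp
  · intro S _ hS
    split_ifs
    · rw [zero_pow (by simpa using hS)]; simp
    · rfl
  · simp

theorem mesymm_zero_cons {R : Type*} [CommRing R] (s : Multiset R) (k : ℕ) :
    ((0 : R) ::ₘ s).esymm k = s.esymm k := by
  cases k with
  | zero => rw [mesymm_zero, mesymm_zero]
  | succ k => rw [mesymm_cons]; simp

theorem stab_step {N : ℕ} (hn : n ≤ N) (c : Nat.Partition n → ℤ)
    (h : ZZ G (1 : MvPolynomial (Fin N) ℤ) (List.ofFn X) univ =
      ∑ p, C (c p) * EP (↑(List.ofFn (X : Fin N → MvPolynomial (Fin N) ℤ))) p) :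
    ZZ G (1 : MvPolynomial (Fin (N + 1)) ℤ) (List.ofFn X) univ =
      ∑ p, C (c p) * EP (↑(List.ofFn (X : Fin (N + 1) → MvPolynomial (Fin (N + 1)) ℤ))) p := by
  rw [← sub_eq_zero]
  apply stab _ _ _ hn
  · set φ : MvPolynomial (Fin (N + 1)) ℤ →+* MvPolynomial (Fin N) ℤ :=
      (Polynomial.constantCoeff).comp (finSuccEquiv ℤ N).toRingEquiv.toRingHom
    have hφ : ∀ f, Polynomial.coeff (finSuccEquiv ℤ N f) 0 = φ f := fun f => rfl
    have hφC : ∀ c : ℤ, φ (C c) = C c := by intro c; simp [φ]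
    have hl : (List.ofFn (X : Fin (N + 1) → MvPolynomial (Fin (N + 1)) ℤ)).map φ =
        0 :: List.ofFn X := by
      rw [List.ofFn_succ, List.map_cons, List.map_ofFn]
      congr 1
      · rw [← hφ, finSuccEquiv_X_zero]; simp
      · congr 1
        ext1 i
        rw [Function.comp_apply, ← hφ, finSuccEquiv_X_succ]; simp
    rw [hφ, map_sub, ZZ_map, map_sum, hl, map_one, ZZ_zero_cons, h, sub_eq_zero]
    refine sum_congr rfl fun p _ => ?_
    rw [map_mul, hφC, map_EP, Multiset.map_coe, hl, ← Multiset.cons_coe]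
    simp only [EP, mesymm_zero_cons]
  · refine (ZZ_symm (q := (1 : ℤ)) ?_ univ).sub ?_
    · intro W x y; rw [C_1]; exact PP_symm_one W x y
    · intro e
      rw [map_sum]
      refine sum_congr rfl fun p _ => ?_
      rw [← eProd_eq, map_mul, rename_C, eProd_symm]
  · refine (ZZ_homog (q := (1 : ℤ))).sub ?_
    refine IsHomogeneous.sum _ _ _ fun p _ => ?_
    rw [← eProd_eq]
    exact (eProd_homog _ _ p).C_mul _

theorem stab_all {N : ℕ} (hn : n ≤ N) (c : Nat.Partition n → ℤ)
    (h : ZZ G (1 : MvPolynomial (Fin N) ℤ) (List.ofFn X) univ =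
      ∑ p, C (c p) * EP (↑(List.ofFn (X : Fin N → MvPolynomial (Fin N) ℤ))) p) (M : ℕ)
    (hM : N ≤ M) : ZZ G (1 : MvPolynomial (Fin M) ℤ) (List.ofFn X) univ =
      ∑ p, C (c p) * EP (↑(List.ofFn (X : Fin M → MvPolynomial (Fin M) ℤ))) p := by
  induction M, hM using Nat.le_induction with
  | base => exact h
  | succ M hM ih => exact stab_step (hn.trans hM) c ih

theorem stab_list {N : ℕ} (hn : n ≤ N) (c : Nat.Partition n → ℤ)
    (h : ZZ G (1 : MvPolynomial (Fin N) ℤ) (List.ofFn X) univ =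
      ∑ p, C (c p) * EP (↑(List.ofFn (X : Fin N → MvPolynomial (Fin N) ℤ))) p) (l : List ℚ)
    (hM : N ≤ l.length) : ZZ G 1 l univ = ∑ p, (c p : ℚ) * EP (↑l) p := by
  have h1 := stab_all hn c h l.length hM
  have hl : (List.ofFn (X : Fin l.length → MvPolynomial (Fin l.length) ℤ)).map
      (eval₂Hom (Int.castRingHom ℚ) l.get) = l := by
    rw [List.map_ofFn]
    conv_rhs => rw [← List.ofFn_get l]
    congr 1
    ext1 i
    simp
  have h2 := congrArg (eval₂Hom (Int.castRingHom ℚ) l.get) h1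
  rw [ZZ_map, map_sum, hl, map_one] at h2
  rw [h2]
  refine sum_congr rfl fun p _ => ?_
  rw [map_mul, map_EP, Multiset.map_coe, hl]
  simp

theorem poly_eq_of_large (P Q : Polynomial ℚ) (N : ℕ)
    (h : ∀ r : ℕ, N ≤ r → P.eval (r : ℚ) = Q.eval (r : ℚ)) : P = Q := by
  apply Polynomial.eq_of_infinite_eval_eq
  refine Set.Infinite.mono (s := (fun r : ℕ => (r : ℚ)) '' Set.Ici N) ?_ ?_
  · rintro _ ⟨r, hr, rfl⟩
    exact h r hr
  · exact (Set.Ici_infinite N).image (Nat.cast_injective.injOn)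

theorem stanley_gen {N : ℕ} (hn : n ≤ N) (c : Nat.Partition n → ℤ)
    (h : ZZ G (1 : MvPolynomial (Fin N) ℤ) (List.ofFn X) univ =
      ∑ p, C (c p) * EP (↑(List.ofFn (X : Fin N → MvPolynomial (Fin N) ℤ))) p) (t : ℚ) :
    ∑ D ∈ AO G univ, t ^ (snk univ D).card = ∑ p, (c p : ℚ) * t ^ numParts p := by
  choose χ hχ hχ' using exists_chi (G := G)
  choose b hb hb' using exists_bin
  let P : Polynomial ℚ := ∑ S ∈ (univ : Finset (Fin n)).powerset, if IsIndepFinset G S then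
    Polynomial.C ((t - 1) ^ S.card) * χ (univ \ S) else 0
  let Q : Polynomial ℚ := ∑ p : Nat.Partition n, Polynomial.C (c p : ℚ) *
    (p.parts.map fun k => b k + Polynomial.C (t - 1) * b (k - 1)).prod
  have hPQ : P = Q := by
    apply poly_eq_of_large _ _ N
    intro r hr
    have h1 := stab_list hn c h ((t - 1) :: List.replicate r (-1)) (by simp; omega)
    have hP : P.eval (r : ℚ) = ZZ G 1 ((t - 1) :: List.replicate r (-1)) univ := by
      rw [ZZ, Polynomial.eval_finsetSum]
      refine sum_congr rfl fun S _ => ?_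
      split_ifs
      · rw [Polynomial.eval_mul, Polynomial.eval_C, hχ]; simp
      · simp
    have hQ : Q.eval (r : ℚ) = ∑ p, (c p : ℚ) * EP (↑((t - 1) :: List.replicate r (-1))) p := by
      rw [Polynomial.eval_finsetSum]
      refine sum_congr rfl fun p _ => ?_
      rw [Polynomial.eval_mul, Polynomial.eval_C, Polynomial.eval_multiset_prod,
        Multiset.map_map, EP]
      congr 2
      refine Multiset.map_congr rfl fun k hk => ?_
      obtain ⟨k, rfl⟩ : ∃ m, k = m + 1 := ⟨k - 1, by have := p.parts_pos hk; omega⟩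
      rw [← Multiset.cons_coe, mesymm_cons, Multiset.coe_replicate]
      simp [hb]
    rw [hP, h1, hQ]
  have h2 := congrArg (Polynomial.eval (-1)) hPQ
  rw [← sum_AO]
  have hP : P.eval (-1) = ∑ S ∈ (univ : Finset (Fin n)).powerset, if IsIndepFinset G S then
      (t - 1) ^ S.card * ((AO G (univ \ S)).card : ℚ) else 0 := by
    rw [Polynomial.eval_finsetSum]
    refine sum_congr rfl fun S _ => ?_
    split_ifs
    · rw [Polynomial.eval_mul, Polynomial.eval_C, hχ']
    · simp
  rw [← hP, h2, Polynomial.eval_finsetSum]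
  refine sum_congr rfl fun p _ => ?_
  rw [Polynomial.eval_mul, Polynomial.eval_C, Polynomial.eval_multiset_prod, Multiset.map_map]
  simp [hb', numParts]

theorem stanley {N : ℕ} (hn : n ≤ N) (c : Nat.Partition n → ℤ)
    (h : ZZ G (1 : MvPolynomial (Fin N) ℤ) (List.ofFn X) univ =
      ∑ p, C (c p) * EP (↑(List.ofFn (X : Fin N → MvPolynomial (Fin N) ℤ))) p) (j : ℕ) :
    ((((AO G univ).filter fun D => (snk univ D).card = j).card : ℕ) : ℤ) =
      ∑ p ∈ univ.filter (fun p : Nat.Partition n => numParts p = j), c p := by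
  have h1 : (∑ D ∈ AO G univ, Polynomial.X ^ (snk univ D).card : Polynomial ℚ) =
      ∑ p, Polynomial.C (c p : ℚ) * Polynomial.X ^ numParts p := by
    apply Polynomial.funext
    intro t
    have := stanley_gen hn c h t
    rw [Polynomial.eval_finsetSum, Polynomial.eval_finsetSum]
    simpa using this
  have h2 := congrArg (fun P => Polynomial.coeff P j) h1
  simp only [Polynomial.finsetSum_coeff, Polynomial.coeff_C_mul, Polynomial.coeff_X_pow] at h2
  have h3 : ((((AO G univ).filter fun D => (snk univ D).card = j).card : ℕ) : ℚ) =
      ∑ p ∈ univ.filter (fun p : Nat.Partition n => numParts p = j), (c p : ℚ) := by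
    rw [sum_filter, card_filter]
    push_cast
    simpa [eq_comm] using h2
  exact_mod_cast h3

end


open Finset MvPolynomial
open scoped Classical

noncomputable section

/-- exponent of the elementary symmetric polynomial `e_{k-d}` -/
def sx (M d k : ℕ) : Fin M →₀ ℕ :=
  if h : d < k ∧ k - d - 1 < M then Finsupp.single ⟨k - d - 1, h.2⟩ 1 else 0

/-- exponent of `∏ e_{k-d}` over the parts `k` -/
def mono {n : ℕ} (M d : ℕ) (p : Nat.Partition n) : Fin M →₀ ℕ := (p.parts.map (sx M d)).sum

variable {n : ℕ} {G : SimpleGraph (Fin n)}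

theorem sx_apply (M d k : ℕ) (i : Fin M) : sx M d k i = if (i : ℕ) + d + 1 = k then 1 else 0 := by
  unfold sx
  have := i.2
  split_ifs with h1 h2 h2
  · subst h2
    have : (⟨i + d + 1 - d - 1, h1.2⟩ : Fin M) = i := Fin.ext (by simp; omega)
    rw [this]; simp
  · rw [Finsupp.single_apply, if_neg]
    intro h
    apply h2
    rw [Fin.ext_iff] at h
    simp at h
    omega
  · exfalso; apply h1; omega
  · rfl

theorem mono_apply (M d : ℕ) (p : Nat.Partition n) (i : Fin M) :
    mono M d p i = p.parts.count ((i : ℕ) + d + 1) := by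
  unfold mono
  generalize p.parts = s
  induction s using Multiset.induction with
  | empty => simp
  | cons a s ih =>
    rw [Multiset.map_cons, Multiset.sum_cons, Finsupp.add_apply, ih, sx_apply, Multiset.count_cons]
    omega

theorem part_le (p : Nat.Partition n) {k : ℕ} (hk : k ∈ p.parts) : k ≤ n := by
  have := Multiset.single_le_sum (fun _ _ => Nat.zero_le _) _ hk
  rwa [p.parts_sum] at this

theorem mono_inj {M d : ℕ} (hd : d ≤ 1) (hn : n ≤ M + d) {p p' : Nat.Partition n}
    (h : mono M d p = mono M d p') : p = p' := by
  have hc : ∀ k, d < k → p.parts.count k = p'.parts.count k := by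
    intro k hk
    by_cases hkn : k ≤ n
    · have := DFunLike.congr_fun h ⟨k - d - 1, by omega⟩
      rw [mono_apply, mono_apply] at this
      have e : k - d - 1 + d + 1 = k := by omega
      simpa [e] using this
    · rw [Multiset.count_eq_zero_of_notMem fun h => hkn (part_le p h),
        Multiset.count_eq_zero_of_notMem fun h => hkn (part_le p' h)]
  have hf : p.parts.filter (1 < ·) = p'.parts.filter (1 < ·) := by
    ext k
    rw [Multiset.count_filter, Multiset.count_filter]
    split_ifs
    · exact hc k (by omega)
    · rfl
  have hr : ∀ p : Nat.Partition n, p.parts = p.parts.filter (1 < ·) +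
      Multiset.replicate (n - (p.parts.filter (1 < ·)).sum) 1 := by
    intro p
    have h1 : p.parts.filter (fun k => ¬ 1 < k) =
        Multiset.replicate (Multiset.card (p.parts.filter (fun k => ¬ 1 < k))) 1 := by
      rw [Multiset.eq_replicate]
      refine ⟨rfl, fun k hk => ?_⟩
      rw [Multiset.mem_filter] at hk
      have := p.parts_pos hk.1
      omega
    have h2 := Multiset.filter_add_not (1 < ·) p.parts
    have h3 := congrArg Multiset.sum h2
    rw [Multiset.sum_add, p.parts_sum, h1, Multiset.sum_replicate] at h3
    have h4 : Multiset.card (p.parts.filter (fun k => ¬ 1 < k)) =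
        n - (p.parts.filter (1 < ·)).sum := by
      simp only [smul_eq_mul, mul_one] at h3
      omega
    rw [h4] at h1
    rw [← h1]
    exact h2.symm
  ext1
  rw [hr p, hr p', hf]

theorem aeval_mono {M d : ℕ} {R : Type*} [CommRing R] (hn : n ≤ M + d)
    (p : Nat.Partition n) (c : R) :
    aeval (fun i : Fin M => esymm (Fin M) R (i + 1)) (monomial (mono M d p) c) =
      C c * (p.parts.map fun k => esymm (Fin M) R (k - d)).prod := by
  have key : ∀ s : Multiset ℕ, (∀ k ∈ s, 0 < k ∧ k ≤ n) →
      aeval (fun i : Fin M => esymm (Fin M) R (i + 1)) (monomial (s.map (sx M d)).sum (1 : R)) =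
        (s.map fun k => esymm (Fin M) R (k - d)).prod := by
    intro s
    induction s using Multiset.induction with
    | empty => intro _; simp
    | cons a s ih =>
      intro hs
      rw [Multiset.map_cons, Multiset.sum_cons, Multiset.map_cons, Multiset.prod_cons,
        ← ih (fun k hk => hs k (Multiset.mem_cons_of_mem hk)), ← one_mul (1 : R),
        ← monomial_mul, map_mul, one_mul]
      congr 1
      have ha := hs a (Multiset.mem_cons_self _ _)
      unfold sx
      split_ifs with h
      · rw [aeval_monomial]
        simp
        congr 1
        omega
      · have : a - d = 0 := by omega
        rw [this, esymm_zero]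
        simp
  have h1 : monomial (mono M d p) c = C c * monomial (mono M d p) 1 := by
    rw [C_mul_monomial, mul_one]
  rw [h1, map_mul, mono, key _ (fun k hk => ⟨p.parts_pos hk, part_le p hk⟩)]
  congr 1
  exact aeval_C _ _

theorem ZZ_empty {R : Type*} [CommRing R] (q : R) (l : List R) : ZZ G q l ∅ = 1 := by
  induction l with
  | nil => simp [ZZ]
  | cons x l ih =>
    rw [ZZ, powerset_empty, sum_singleton, if_pos (by intro i hi; simp at hi)]
    rw [ascST_eq_zero (by intro i hi; simp at hi)]
    simp [ih]

theorem ZZ_all_zero {R : Type*} [CommRing R] (q : R) (N : ℕ) {U : Finset (Fin n)}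
    (hU : U.Nonempty) : ZZ G q (List.replicate N 0) U = 0 := by
  induction N with
  | zero => simp [ZZ, hU.ne_empty]
  | succ N ih => rw [List.replicate_succ, ZZ_zero_cons, ih]

theorem upper {M : ℕ} {R : Type*} [CommRing R] {q : R} (hn : n ≤ M + 1)
    (c : Nat.Partition n → R)
    (h : ZZ G (C q : MvPolynomial (Fin (M + 1)) R) (List.ofFn X) univ =
      ∑ p, C (c p) * EP (↑(List.ofFn (X : Fin (M + 1) → MvPolynomial (Fin (M + 1)) R))) p)
    (p₀ : Nat.Partition n) (hp₀ : c p₀ ≠ 0) :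
    ∃ S : Finset (Fin n), IsIndepFinset G S ∧ numParts p₀ ≤ S.card := by
  obtain ⟨p₁, hp₁, hmax⟩ := exists_max_image (univ.filter fun p : Nat.Partition n => c p ≠ 0)
    numParts ⟨p₀, by simpa using hp₀⟩
  have hle := hmax p₀ (by simpa using hp₀)
  rw [mem_filter] at hp₁
  by_contra! hcon
  set L := numParts p₁ with hL
  set φ : MvPolynomial (Fin (M + 1)) R →+* Polynomial (MvPolynomial (Fin M) R) :=
    (finSuccEquiv R M).toRingEquiv.toRingHom
  have hφ : ∀ f, (finSuccEquiv R M f) = φ f := fun f => rfl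
  have hφC : ∀ c : R, φ (C c) = Polynomial.C (C c) := by
    intro c; rw [← hφ, finSuccEquiv_apply]; simp
  have hl : (List.ofFn (X : Fin (M + 1) → MvPolynomial (Fin (M + 1)) R)).map φ =
      Polynomial.X :: (List.ofFn X).map Polynomial.C := by
    rw [List.ofFn_succ, List.map_cons, List.map_ofFn, List.map_ofFn]
    congr 1
    · rw [← hφ, finSuccEquiv_X_zero]
    · congr 1
      ext1 i
      rw [Function.comp_apply, ← hφ, finSuccEquiv_X_succ]; simp
  have h1 := congrArg (fun f => Polynomial.coeff (φ f) L) h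
  beta_reduce at h1
  have hlhs : Polynomial.coeff (φ (ZZ G (C q : MvPolynomial (Fin (M + 1)) R)
      (List.ofFn X) univ)) L = 0 := by
    rw [ZZ_map, hl, hφC, ZZ, Polynomial.finsetSum_coeff]
    refine sum_eq_zero fun S _ => ?_
    split_ifs with hS
    · rw [← ZZ_map, ← map_pow, mul_assoc, Polynomial.coeff_C_mul, Polynomial.coeff_mul_C,
        Polynomial.coeff_X_pow, if_neg]
      · simp
      · have := hcon S hS
        omega
    · simp
  rw [hlhs, map_sum, Polynomial.finsetSum_coeff] at h1
  have hrhs : ∀ p : Nat.Partition n, Polynomial.coeff (φ (C (c p) *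
      EP (↑(List.ofFn (X : Fin (M + 1) → MvPolynomial (Fin (M + 1)) R))) p)) L =
      aeval (fun i : Fin M => esymm (Fin M) R (i + 1))
        (monomial (mono M 1 p) (if numParts p = L then c p else 0)) := by
    intro p
    rw [aeval_mono hn, map_mul, hφC, Polynomial.coeff_C_mul]
    by_cases hc : c p = 0
    · simp [hc]
    have hpL : numParts p ≤ L := hmax p (by simpa using hc)
    rw [map_EP, Multiset.map_coe, hl, EP, ← Multiset.cons_coe]
    have e : (p.parts.map fun k => Multiset.esymm (Polynomial.X ::ₘ (((List.ofFn
        (X : Fin M → MvPolynomial (Fin M) R)).map Polynomial.C : List _) : Multiset _)) k) =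
        p.parts.map fun k => Polynomial.C (esymm (Fin M) R k) +
          Polynomial.X * Polynomial.C (esymm (Fin M) R (k - 1)) := by
      refine Multiset.map_congr rfl fun k hk => ?_
      obtain ⟨k, rfl⟩ : ∃ m, k = m + 1 := ⟨k - 1, by have := p.parts_pos hk; omega⟩
      rw [mesymm_cons, ← Multiset.map_coe, ← map_mesymm, ← map_mesymm, esymm_eq_ofFn,
        esymm_eq_ofFn]
      simp
    rw [e]
    have hdeg : ∀ k : ℕ, (Polynomial.C (esymm (Fin M) R k) +
          Polynomial.X * Polynomial.C (esymm (Fin M) R (k - 1))).natDegree ≤ 1 := by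
      intro k
      rw [add_comm, mul_comm]
      exact Polynomial.natDegree_linear_le
    split_ifs with hp
    · have := Polynomial.coeff_multiset_prod_of_natDegree_le (p.parts.map fun k =>
        Polynomial.C (esymm (Fin M) R k) +
          Polynomial.X * Polynomial.C (esymm (Fin M) R (k - 1))) 1 (by
          intro f hf
          rw [Multiset.mem_map] at hf
          obtain ⟨k, _, rfl⟩ := hf
          exact hdeg k)
      rw [Multiset.card_map, mul_one] at this
      rw [← hp, numParts, this, Multiset.map_map]
      simp [Polynomial.coeff_C]
    · rw [Polynomial.coeff_eq_zero_of_natDegree_lt]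
      · simp
      · refine lt_of_le_of_lt (Polynomial.natDegree_multiset_prod_le _) ?_
        refine lt_of_le_of_lt (b := numParts p) ?_ (lt_of_le_of_ne hpL hp)
        rw [Multiset.map_map, numParts]
        have := Multiset.sum_map_le_sum_map (s := p.parts) (f := Polynomial.natDegree ∘ fun k =>
          Polynomial.C (esymm (Fin M) R k) +
          Polynomial.X * Polynomial.C (esymm (Fin M) R (k - 1))) (g := fun _ => 1)
          (fun k _ => hdeg k)
        simpa using this
  rw [sum_congr rfl (fun p _ => hrhs p), ← map_sum, ← esymmAlgHom_apply] at h1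
  have h2 : (∑ p : Nat.Partition n, monomial (mono M 1 p) (if numParts p = L then c p else 0)) =
      (0 : MvPolynomial (Fin M) R) := by
    apply esymmAlgHom_fin_injective R (le_refl M)
    rw [map_zero]
    exact Subtype.ext h1.symm
  have h3 := congrArg (coeff (mono M 1 p₁)) h2
  rw [coeff_sum, coeff_zero, sum_eq_single p₁] at h3
  · rw [coeff_monomial, if_pos rfl, if_pos rfl] at h3
    exact hp₁.2 h3
  · intro p _ hp
    rw [coeff_monomial, if_neg]
    exact fun h => hp (mono_inj le_rfl hn h)
  · simp

theorem degree_mono {N : ℕ} (hn : n ≤ N) (p : Nat.Partition n) :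
    (mono N 0 p).degree = numParts p := by
  have key : ∀ s : Multiset ℕ, (∀ k ∈ s, 0 < k ∧ k ≤ n) →
      ((s.map (sx N 0)).sum).degree = Multiset.card s := by
    intro s
    induction s using Multiset.induction with
    | empty => intro _; simp
    | cons a s ih =>
      intro hs
      have ha := hs a (Multiset.mem_cons_self _ _)
      rw [Multiset.map_cons, Multiset.sum_cons, map_add,
        ih (fun k hk => hs k (Multiset.mem_cons_of_mem hk)), Multiset.card_cons, sx,
        dif_pos (by omega)]
      simp [add_comm]
  exact key _ (fun k hk => ⟨p.parts_pos hk, part_le p hk⟩)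

theorem lower {N : ℕ} {R : Type*} [CommRing R] {q : R} (hn : n ≤ N)
    (hP : ∀ W (x y : MvPolynomial (Fin N) R), PP G (C q) x y W = PP G (C q) y x W)
    (c : Nat.Partition n → R)
    (h : ZZ G (C q : MvPolynomial (Fin N) R) (List.ofFn X) univ =
      ∑ p, C (c p) * EP (↑(List.ofFn (X : Fin N → MvPolynomial (Fin N) R))) p)
    (p₀ : Nat.Partition n) (hp₀ : c p₀ ≠ 0) :
    Fintype.card G.ConnectedComponent ≤ numParts p₀ := by
  by_contra! hcon
  let A : G.ConnectedComponent → Finset (Fin n) := fun c => univ.filter fun v =>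
    G.connectedComponentMk v = c
  have hA : (univ : Finset (Fin n)) = univ.biUnion A := by
    ext v; simp [A]
  have h1 := ZZ_biUnion (G := G) (q := (C q : MvPolynomial (Fin N) R)) (l := List.ofFn X)
    univ A (by
      intro i j hij
      rw [disjoint_left]
      intro v hv hv'
      simp only [A, mem_filter, mem_univ, true_and] at hv hv'
      exact hij (hv.symm.trans hv')) (by
      intro i j hij a ha b hb hab
      simp only [A, mem_filter, mem_univ, true_and] at ha hb
      apply hij
      rw [← ha, ← hb]
      exact SimpleGraph.ConnectedComponent.sound hab.reachable)
  rw [← hA, h, ZZ_empty, one_mul] at h1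
  have h2 : ∀ i, ∃ g : MvPolynomial (Fin N) R, (esymmAlgHom (Fin N) R N g).val =
      ZZ G (C q) (List.ofFn X) (A i) := by
    intro i
    obtain ⟨g, hg⟩ := (esymmAlgHom_fin_bijective R N).2 ⟨_, ZZ_symm (G := G) hP (A i)⟩
    exact ⟨g, by rw [hg]⟩
  choose g hg using h2
  have hg0 : ∀ i, g i ∈ idealOfVars (Fin N) R := by
    intro i
    rw [← pow_one (idealOfVars (Fin N) R), mem_pow_idealOfVars_iff']
    intro x hx
    have hx0 : x = 0 := by
      rw [← Finsupp.degree_eq_zero_iff]; omega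
    subst hx0
    have e1 : ∀ f : MvPolynomial (Fin N) R, constantCoeff (aeval
        (fun i : Fin N => esymm (Fin N) R (i + 1)) f) = constantCoeff f := by
      intro f
      have : (constantCoeff : MvPolynomial (Fin N) R →+* R).comp ((aeval
        (fun i : Fin N => esymm (Fin N) R (i + 1)) : _ →ₐ[R] _).toRingHom) = constantCoeff := by
        apply MvPolynomial.ringHom_ext
        · intro r
          simp
        · intro i
          simp only [AlgHom.toRingHom_eq_coe, RingHom.comp_apply, RingHom.coe_coe, aeval_X,
            constantCoeff_X]
          rw [constantCoeff_eq]
          by_contra hne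
          have := esymm_homog N R (i + 1) hne
          simp at this
      exact RingHom.congr_fun this f
    change constantCoeff (g i) = 0
    rw [← e1, ← esymmAlgHom_apply, hg, ZZ_map, List.map_ofFn]
    have e2 : (constantCoeff : MvPolynomial (Fin N) R →+* R) ∘ (X : Fin N → _) =
        fun _ => 0 := by
      ext i; simp
    rw [e2, List.ofFn_const, ZZ_all_zero]
    obtain ⟨v, hv⟩ := i.exists_rep
    exact ⟨v, mem_filter.2 ⟨mem_univ _, hv⟩⟩
  have h3 : (∑ p : Nat.Partition n, monomial (mono N 0 p) (c p)) = ∏ i, g i := by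
    apply esymmAlgHom_fin_injective R (le_refl N)
    apply Subtype.ext
    rw [esymmAlgHom_apply, map_sum, map_prod, ← Subalgebra.val_apply, map_prod]
    refine Eq.trans ?_ (h1.trans (prod_congr rfl (fun i _ => (hg i).symm)))
    refine sum_congr rfl fun p _ => ?_
    rw [aeval_mono (by omega), EP]
    simp only [esymm_eq_ofFn, Nat.sub_zero]
  have h4 : ∏ i, g i ∈ idealOfVars (Fin N) R ^ Fintype.card G.ConnectedComponent := by
    have := Ideal.prod_mem_prod (s := univ) (I := fun _ : G.ConnectedComponent =>
      idealOfVars (Fin N) R) (x := g) (fun i _ => hg0 i)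
    simpa using this
  rw [← h3, mem_pow_idealOfVars_iff'] at h4
  have h5 := h4 (mono N 0 p₀) (by rw [degree_mono hn]; exact hcon)
  rw [coeff_sum, sum_eq_single p₀] at h5
  · rw [coeff_monomial, if_pos rfl] at h5
    exact hp₀ h5
  · intro p _ hp
    rw [coeff_monomial, if_neg]
    exact fun h => hp (mono_inj (by omega) (by omega) h)
  · simp

end


open Finset MvPolynomial
open scoped Classical

noncomputable section

variable {n : ℕ} {G : SimpleGraph (Fin n)}

theorem exists_indep {j : ℕ} {S₀ : Finset (Fin n)} (h0 : IsIndepFinset G S₀) (hj : j ≤ S₀.card)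
    (hc : Fintype.card G.ConnectedComponent ≤ j) :
    ∃ S : Finset (Fin n), IsIndepFinset G S ∧ S.card = j ∧ ∀ v, ∃ s ∈ S, G.Reachable v s := by
  obtain ⟨M, hM, hmax⟩ := exists_max_image
    (univ.filter fun S : Finset (Fin n) => IsIndepFinset G S) Finset.card ⟨S₀, by simpa using h0⟩
  have hM := (mem_filter.1 hM).2
  have hMj : j ≤ M.card := hj.trans (hmax S₀ (by simpa using h0))
  have hmeet : ∀ i : G.ConnectedComponent, ∃ v ∈ M, G.connectedComponentMk v = i := by
    intro i
    by_contra! hcon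
    obtain ⟨v, rfl⟩ := i.exists_rep
    have hv : v ∉ M := fun h => hcon v h rfl
    have hadj : ∀ w ∈ M, ¬ G.Adj v w := fun w hw h =>
      hcon w hw (SimpleGraph.ConnectedComponent.sound h.symm.reachable)
    have hi : IsIndepFinset G (insert v M) := by
      intro a ha b hb hab
      rw [mem_insert] at ha hb
      rcases ha with rfl | ha <;> rcases hb with rfl | hb
      · exact G.loopless.irrefl _ hab
      · exact hadj b hb hab
      · exact hadj a ha hab.symm
      · exact hM a ha b hb hab
    have := hmax _ (mem_filter.2 ⟨mem_univ _, hi⟩)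
    rw [card_insert_of_notMem hv] at this
    omega
  choose r hr hr' using hmeet
  obtain ⟨S, hS1, hS2, hS3⟩ := exists_subsuperset_card_eq (s := univ.image r) (t := M) (n := j)
    (by intro x hx; obtain ⟨i, _, rfl⟩ := mem_image.1 hx; exact hr i)
    (card_image_le.trans hc) hMj
  refine ⟨S, fun a ha b hb => hM a (hS2 ha) b (hS2 hb), hS3, fun v => ?_⟩
  refine ⟨r (G.connectedComponentMk v), hS1 (mem_image_of_mem _ (mem_univ _)), ?_⟩
  exact (SimpleGraph.ConnectedComponent.exact (hr' (G.connectedComponentMk v))).symm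

theorem exists_AO {S : Finset (Fin n)} (hS : IsIndepFinset G S)
    (hr : ∀ v, ∃ s ∈ S, G.Reachable v s) : ∃ D ∈ AO G univ, snk univ D = S := by
  let A : Fin n → Set ℕ := fun v => {k | ∃ s ∈ S, ∃ w : G.Walk v s, w.length = k}
  let d : Fin n → ℕ := fun v => sInf (A v)
  have hne : ∀ v, (A v).Nonempty := by
    intro v
    obtain ⟨s, hs, ⟨w⟩⟩ := hr v
    exact ⟨_, s, hs, w, rfl⟩
  have hd0 : ∀ v, v ∈ S → d v = 0 := by
    intro v hv
    exact Nat.le_zero.1 (Nat.sInf_le ⟨v, hv, SimpleGraph.Walk.nil, rfl⟩)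
  have hdS : ∀ v, d v = 0 → v ∈ S := by
    intro v hv
    obtain ⟨s, hs, w, hw⟩ := Nat.sInf_mem (hne v)
    change _ = d v at hw
    rw [hv] at hw
    rwa [SimpleGraph.Walk.eq_of_length_eq_zero hw]
  have hnb : ∀ v, v ∉ S → ∃ u, G.Adj v u ∧ d u < d v := by
    intro v hv
    obtain ⟨s, hs, w, hw⟩ := Nat.sInf_mem (hne v)
    change _ = d v at hw
    cases w with
    | nil => exact absurd hs hv
    | @cons _ u _ h w' =>
      refine ⟨u, h, ?_⟩
      have : d u ≤ w'.length := Nat.sInf_le ⟨s, hs, w', rfl⟩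
      rw [SimpleGraph.Walk.length_cons] at hw
      omega
  let h : Fin n → ℕ := fun v => d v * n + v
  have hlt : ∀ u v, d u < d v → h u < h v := by
    intro u v huv
    have h1 : (d u + 1) * n ≤ d v * n := Nat.mul_le_mul_right _ huv
    have h2 := u.2
    simp only [h]
    nlinarith
  have hinj : ∀ u v, u ≠ v → h u < h v ∨ h v < h u := by
    intro u v huv
    rcases lt_trichotomy (d u) (d v) with h1 | h1 | h1
    · exact Or.inl (hlt _ _ h1)
    · have : (u : ℕ) ≠ v := fun h => huv (Fin.ext h)
      simp only [h, h1]
      omega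
    · exact Or.inr (hlt _ _ h1)
  refine ⟨univ.filter fun e => G.Adj e.1 e.2 ∧ h e.2 < h e.1, ?_, ?_⟩
  · rw [mem_AO]
    refine ⟨?_, ?_, h, ?_⟩
    · intro a b hab
      exact ⟨mem_univ _, mem_univ _, (mem_filter.1 hab).2.1⟩
    · intro a _ b _ hab
      simp only [mem_filter, mem_univ, true_and]
      rcases hinj a b hab.ne with h1 | h1
      · exact Or.inr ⟨hab.symm, h1⟩
      · exact Or.inl ⟨hab, h1⟩
    · intro a b hab
      exact (mem_filter.1 hab).2.2
  · ext v
    rw [mem_snk]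
    simp only [mem_filter, mem_univ, true_and]
    constructor
    · intro hv
      by_contra hvS
      obtain ⟨u, hu, hud⟩ := hnb v hvS
      exact hv u ⟨hu, hlt _ _ hud⟩
    · rintro hv w ⟨hvw, hw⟩
      by_cases hwd : d w = 0
      · exact hS v hv w (hdS w hwd) hvw
      · have h1 := hd0 v hv
        have := hlt v w (by omega)
        omega

theorem main_pos {N : ℕ} {j : ℕ} (hn : n ≤ N) (c : Nat.Partition n → ℤ)
    (h : ZZ G (1 : MvPolynomial (Fin N) ℤ) (List.ofFn X) univ =
      ∑ p, C (c p) * EP (↑(List.ofFn (X : Fin N → MvPolynomial (Fin N) ℤ))) p)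
    {S₀ : Finset (Fin n)} (h0 : IsIndepFinset G S₀) (hj : j ≤ S₀.card)
    (hc : Fintype.card G.ConnectedComponent ≤ j) :
    ∑ p ∈ univ.filter (fun p : Nat.Partition n => numParts p = j), c p ≠ 0 := by
  rw [← stanley hn c h j]
  obtain ⟨S, hS, hSj, hr⟩ := exists_indep h0 hj hc
  obtain ⟨D, hD, hDS⟩ := exists_AO hS hr
  have : 0 < ((AO G univ).filter fun D => (snk univ D).card = j).card :=
    card_pos.2 ⟨D, mem_filter.2 ⟨hD, by rw [hDS, hSj]⟩⟩
  exact_mod_cast this.ne'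

/-- support bounds -/
theorem support_bounds {N : ℕ} {R : Type} [CommRing R] {q : R} (hn : n ≤ N)
    (hP : ∀ W (x y : MvPolynomial (Fin N) R), PP G (C q) x y W = PP G (C q) y x W)
    (c : Nat.Partition n → R)
    (h : ZZ G (C q : MvPolynomial (Fin N) R) (List.ofFn X) univ =
      ∑ p, C (c p) * EP (↑(List.ofFn (X : Fin N → MvPolynomial (Fin N) R))) p)
    (p₀ : Nat.Partition n) (hp₀ : c p₀ ≠ 0) :
    Fintype.card G.ConnectedComponent ≤ numParts p₀ ∧
      ∃ S : Finset (Fin n), IsIndepFinset G S ∧ numParts p₀ ≤ S.card := by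
  refine ⟨lower hn hP c h p₀ hp₀, ?_⟩
  cases N with
  | zero =>
    obtain rfl : n = 0 := by omega
    refine ⟨∅, by intro i hi; simp at hi, ?_⟩
    have : p₀.parts = 0 := by
      rw [Multiset.eq_zero_iff_forall_notMem]
      intro k hk
      have h1 := p₀.parts_pos hk
      have h2 := part_le p₀ hk
      omega
    simp [numParts, this]
  | succ M => exact upper hn c h p₀ hp₀

end

/-- if some `c_λ ≠ 0` with `λ'_1 = j` then the sum
`a_j = Σ_{λ'_1 = j} c_λ` is nonzero; and for natural unit interval graphs the
same holds for the `q`-coefficients. -/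
theorem stmt6 (n N : ℕ) (hN : n ≤ N) (j : ℕ) (G : SimpleGraph (Fin n)) :
    (∀ c : Nat.Partition n → ℤ,
      chromSym n N G = ∑ p : Nat.Partition n, C (c p) * eProd N ℤ p →
      (∃ p, numParts p = j ∧ c p ≠ 0) →
      ∑ p ∈ Finset.univ.filter (fun p : Nat.Partition n => numParts p = j), c p ≠ 0) ∧
    (IsNUIG G →
      ∀ c : Nat.Partition n → Polynomial ℤ,
      chromQSym n N G = ∑ p : Nat.Partition n, C (c p) * eProd N (Polynomial ℤ) p →
      (∃ p, numParts p = j ∧ c p ≠ 0) →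
      ∑ p ∈ Finset.univ.filter (fun p : Nat.Partition n => numParts p = j), c p ≠ 0) := by
  refine ⟨?_, ?_⟩
  · intro c h ⟨p₀, hpj, hp₀⟩
    rw [chromSym_eq] at h
    simp only [eProd_eq] at h
    obtain ⟨h1, S, hS, h2⟩ := support_bounds (G := G) (q := (1 : ℤ)) hN
      (by intro W x y; rw [C_1]; exact PP_symm_one W x y) c (by rw [C_1]; exact h) p₀ hp₀
    rw [hpj] at h1 h2
    exact main_pos hN c h hS h2 h1
  · intro hG c h ⟨p₀, hpj, hp₀⟩
    rw [chromQSym_eq] at h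
    simp only [eProd_eq] at h
    obtain ⟨h1, S, hS, h2⟩ := support_bounds (G := G) hN
      (fun W x y => (PP_key hG _ W).1 x y) c h p₀ hp₀
    rw [hpj] at h1 h2
    intro h0
    have h3 := congrArg (MvPolynomial.map (Polynomial.evalRingHom (1 : ℤ))) h
    have hl : (List.ofFn (X : Fin N → MvPolynomial (Fin N) (Polynomial ℤ))).map
        (MvPolynomial.map (Polynomial.evalRingHom (1 : ℤ))) = List.ofFn X := by
      rw [List.map_ofFn]
      congr 1
      ext1 i
      simp
    rw [ZZ_map, hl, map_sum] at h3
    refine main_pos hN (fun p => (c p).eval 1) ?_ hS h2 h1 ?_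
    · convert h3 using 1
      · simp
      · refine sum_congr rfl fun p _ => ?_
        rw [map_mul, map_EP, Multiset.map_coe, hl]
        simp
    · have := congrArg (Polynomial.eval 1) h0
      rw [Polynomial.eval_finsetSum] at this
      simpa using this
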